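/- arXiv:2203.05117 — 6 statements merged into one kernel-verified Lean document; each statement's English description precedes it below -/
import Mathlib

section
/- Saddle-point property: let x* ∈ X be a minimizer of f over X, let π*_i ∈ argmax_{π_i∈Π_i} (⟨A_ix*, π_i⟩ − f_i*(π_i)) for i = 1,…,m and p* ∈ argmax_{p∈P} (Σᵢ pᵢ f_i(x*) − ρ*(p)) be chosen so that the first-order optimality condition of min_{x∈X} f holds at x* with these multipliers (such choices exist). Then z* := (x*; p*, π*) satisfies Q(z; z*) ≥ 0 for every z = (x; p, π) ∈ X×P×Π. -/
open RealInnerProductSpace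

/-- **Saddle-point property** (Lemma 2.2, eq. (2.5)): if `x*` minimizes `f` over `X`,
`π*ᵢ` maximizes `⟨A_i x*, ·⟩ − f_i*` over `Π_i`, `p*` maximizes `∑ᵢ pᵢ f_i(x*) − ρ*(p)`
over `P`, and the first-order optimality condition of `min_{x∈X} f` holds at `x*` with
these multipliers (i.e. `⟨∑ᵢ p*ᵢ A_iᵀ π*ᵢ + g*, x − x*⟩ ≥ 0` on `X` for some subgradient
`g*` of `u` at `x*`), then `z* = (x*; p*, π*)` satisfies `Q(z; z*) ≥ 0` for all
`z = (x; p, π) ∈ X × P × Π`. -/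
theorem saddle_point_property
    (n m : ℕ) (hm : 1 ≤ m) (d : Fin m → ℕ)
    (X : Set (EuclideanSpace ℝ (Fin n)))
    (hXne : X.Nonempty) (hXcl : IsClosed X) (hXcv : Convex ℝ X)
    (P : Set (Fin m → ℝ))
    (hPne : P.Nonempty) (hPcl : IsClosed P) (hPcv : Convex ℝ P)
    (hPsub : ∀ p ∈ P, (∑ i, p i) = 1 ∧ ∀ i, 0 ≤ p i)
    (Pis : (i : Fin m) → Set (EuclideanSpace ℝ (Fin (d i))))
    (hPisne : ∀ i, (Pis i).Nonempty) (hPiscl : ∀ i, IsClosed (Pis i))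
    (hPiscv : ∀ i, Convex ℝ (Pis i))
    (A : (i : Fin m) → EuclideanSpace ℝ (Fin n) →L[ℝ] EuclideanSpace ℝ (Fin (d i)))
    (fistar : (i : Fin m) → EuclideanSpace ℝ (Fin (d i)) → ℝ)
    (hfistarcv : ∀ i, ConvexOn ℝ Set.univ (fistar i))
    (hfistarlsc : ∀ i, LowerSemicontinuous (fistar i))
    (u : EuclideanSpace ℝ (Fin n) → ℝ) (hucv : ConvexOn ℝ Set.univ u)
    (ρstar : (Fin m → ℝ) → ℝ)
    (hρcv : ConvexOn ℝ Set.univ ρstar) (hρlsc : LowerSemicontinuous ρstar)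
    (fi : Fin m → EuclideanSpace ℝ (Fin n) → ℝ)
    (hfi : ∀ i, ∀ x ∈ X,
      IsLUB ((fun πi => ⟪A i x, πi⟫ - fistar i πi) '' Pis i) (fi i x))
    (f : EuclideanSpace ℝ (Fin n) → ℝ)
    (hf : ∀ x ∈ X,
      IsLUB ((fun p => (∑ i, p i * fi i x) - ρstar p) '' P) (f x - u x))
    (xstar : EuclideanSpace ℝ (Fin n)) (hxstar : xstar ∈ X) (hmin : IsMinOn f X xstar)
    (pistar : (i : Fin m) → EuclideanSpace ℝ (Fin (d i)))
    (hpistar : ∀ i, pistar i ∈ Pis i ∧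
      IsMaxOn (fun πi => ⟪A i xstar, πi⟫ - fistar i πi) (Pis i) (pistar i))
    (pstar : Fin m → ℝ) (hpstar : pstar ∈ P)
    (hpstarmax : IsMaxOn (fun p => (∑ i, p i * fi i xstar) - ρstar p) P pstar)
    -- first-order optimality condition at `x*` with the multipliers `(p*, π*)`
    (gstar : EuclideanSpace ℝ (Fin n))
    (hgstar : ∀ y, u xstar + ⟪gstar, y - xstar⟫ ≤ u y)
    (hfoc : ∀ x ∈ X,
      0 ≤ ⟪(∑ i, pstar i • (ContinuousLinearMap.adjoint (A i)) (pistar i)) + gstar,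
            x - xstar⟫) :
    ∀ x ∈ X, ∀ p ∈ P, ∀ π : (i : Fin m) → EuclideanSpace ℝ (Fin (d i)),
      (∀ i, π i ∈ Pis i) →
      0 ≤ ((∑ i, pstar i * (⟪A i x, pistar i⟫ - fistar i (pistar i))) - ρstar pstar + u x)
        - ((∑ i, p i * (⟪A i xstar, π i⟫ - fistar i (π i))) - ρstar p + u xstar) := by
  intro x hx p hp π hπ
  -- the value of `fi` at `x*` is attained at `π*`
  have hval : ∀ i, fi i xstar = ⟪A i xstar, pistar i⟫ - fistar i (pistar i) := by
    intro i
    apply le_antisymm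
    · apply (hfi i xstar hxstar).2
      rintro _ ⟨q, hq, rfl⟩
      exact (hpistar i).2 hq
    · exact (hfi i xstar hxstar).1 ⟨pistar i, (hpistar i).1, rfl⟩
  have h1 : ∑ i, p i * (⟪A i xstar, π i⟫ - fistar i (π i)) ≤ ∑ i, p i * fi i xstar := by
    apply Finset.sum_le_sum
    intro i _
    exact mul_le_mul_of_nonneg_left ((hfi i xstar hxstar).1 ⟨π i, hπ i, rfl⟩)
      ((hPsub p hp).2 i)
  have h2 : (∑ i, p i * fi i xstar) - ρstar p
      ≤ (∑ i, pstar i * fi i xstar) - ρstar pstar := hpstarmax hp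
  have h3 := hgstar x
  have h4 := hfoc x hx
  have h5 : ⟪∑ i, pstar i • (ContinuousLinearMap.adjoint (A i)) (pistar i), x - xstar⟫
      = (∑ i, pstar i * (⟪A i x, pistar i⟫ - fistar i (pistar i)))
        - ∑ i, pstar i * fi i xstar := by
    rw [sum_inner, ← Finset.sum_sub_distrib]
    apply Finset.sum_congr rfl
    intro i _
    rw [real_inner_smul_left, ContinuousLinearMap.adjoint_inner_left, map_sub, inner_sub_right,
      hval i, real_inner_comm (pistar i) (A i x), real_inner_comm (pistar i) (A i xstar)]
    ring
  rw [inner_add_left, h5] at h4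
  linarith
end

section
/- Aggregate strong convexity of the weighted conjugate Bregman distances (Lemma 3.2): in the smooth setting, let p̂ ∈ P be given. If π_i = ∇f_i(x) and π̄_i = ∇f_i(x̄) for some x, x̄ ∈ ℝⁿ, then Σᵢ p̂ᵢ W_{f_i*}(π_i; π̄_i) ≥ (1/(2L_f)) ‖Σᵢ p̂ᵢ(π_i − π̄_i)‖², where W_{f_i*}(π; π̄) := f_i*(π) − f_i*(π̄) − ⟨x̄, π − π̄⟩ is the Bregman distance generated by the Fenchel conjugate f_i* (note ∇f_i*(π̄_i) = x̄). -/
open RealInnerProductSpace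

section helpers
variable {E : Type*} [NormedAddCommGroup E] [InnerProductSpace ℝ E]

theorem aux_line {f : E → ℝ} {g x v : E} {t : ℝ}
    (h : HasFDerivAt f (innerSL ℝ g) (x + t • v)) :
    HasDerivAt (fun s : ℝ => f (x + s • v)) ⟪g, v⟫ t := by
  have h1 : HasDerivAt (fun s : ℝ => x + s • v) v t := by
    simpa using ((hasDerivAt_id t).smul_const v).const_add x
  exact h.comp_hasDerivAt t h1

theorem aux_convex {f : E → ℝ} (hc : ConvexOn ℝ Set.univ f) {g x : E}
    (h : HasFDerivAt f (innerSL ℝ g) x) (y : E) :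
    f x + ⟪g, y - x⟫ ≤ f y := by
  have h0 : HasDerivAt (fun s : ℝ => f (x + s • (y - x))) ⟪g, y - x⟫ 0 :=
    aux_line (by simpa using h)
  have hc' : ConvexOn ℝ Set.univ (fun s : ℝ => f (x + s • (y - x))) := by
    have := hc.comp_affineMap (AffineMap.lineMap (k := ℝ) x y)
    have he : (f ∘ (AffineMap.lineMap (k := ℝ) x y)) = fun s : ℝ => f (x + s • (y - x)) := by
      funext s
      simp [AffineMap.lineMap_apply, add_comm]
    rw [he] at this
    exact this
  have := hc'.le_slope_of_hasDerivAt (Set.mem_univ 0) (Set.mem_univ 1) one_pos h0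
  simp [slope_def_field] at this
  linarith

theorem aux_descent {f : E → ℝ} {g : E → E} {L : ℝ}
    (h : ∀ x, HasFDerivAt f (innerSL ℝ (g x)) x)
    (hL : ∀ x y, ‖g x - g y‖ ≤ L * ‖x - y‖) (x v : E) :
    f (x + v) ≤ f x + ⟪g x, v⟫ + L / 2 * ‖v‖ ^ 2 := by
  have hd : ∀ t : ℝ, HasDerivAt
      (fun s : ℝ => f (x + s • v) - s * ⟪g x, v⟫ - s ^ 2 * (L / 2 * ‖v‖ ^ 2))
      (⟪g (x + t • v), v⟫ - ⟪g x, v⟫ - 2 * t * (L / 2 * ‖v‖ ^ 2)) t := by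
    intro t
    have h2 := (hasDerivAt_id t).mul_const ⟪g x, v⟫
    have h3 := (hasDerivAt_pow 2 t).mul_const (L / 2 * ‖v‖ ^ 2)
    have := ((aux_line (h (x + t • v))).sub h2).sub h3
    have he : ⟪g (x + t • v), v⟫ - ⟪g x, v⟫ - 2 * t * (L / 2 * ‖v‖ ^ 2)
        = ⟪g (x + t • v), v⟫ - 1 * ⟪g x, v⟫
          - ((2 : ℕ) : ℝ) * t ^ (2 - 1) * (L / 2 * ‖v‖ ^ 2) := by
      simp
    rw [he]
    exact this
  have ha := antitoneOn_of_deriv_nonpos (convex_Icc (0:ℝ) 1)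
    (fun t _ => (hd t).continuousAt.continuousWithinAt)
    (fun t _ => (hd t).differentiableAt.differentiableWithinAt)
    (by
      intro t ht
      rw [interior_Icc] at ht
      rw [(hd t).deriv, ← inner_sub_left]
      have h1 := real_inner_le_norm (g (x + t • v) - g x) v
      have h2 := hL (x + t • v) x
      rw [add_sub_cancel_left, norm_smul, Real.norm_of_nonneg ht.1.le] at h2
      nlinarith [mul_le_mul_of_nonneg_right h2 (norm_nonneg v)])
  have := ha (Set.left_mem_Icc.2 zero_le_one) (Set.right_mem_Icc.2 zero_le_one) zero_le_one
  simp at this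
  linarith

end helpers

/-- **Aggregate strong convexity of the weighted conjugate Bregman distances** (Lemma 3.2):
in the smooth setting, if `π_i = ∇f_i(x)` and `π̄_i = ∇f_i(x̄)`, then
`∑ᵢ p̂ᵢ W_{f_i*}(π_i; π̄_i) ≥ (1/(2 L_f)) ‖∑ᵢ p̂ᵢ (π_i − π̄_i)‖²`, where
`W_{f_i*}(π; π̄) = f_i*(π) − f_i*(π̄) − ⟨x̄, π − π̄⟩` (note `∇f_i*(π̄_i) = x̄`). -/
theorem aggregate_conjugate_bregman_strong_convexity
    (n m : ℕ) (hm : 1 ≤ m)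
    (P : Set (Fin m → ℝ))
    (hPne : P.Nonempty) (hPcl : IsClosed P) (hPcv : Convex ℝ P)
    (hPsub : ∀ p ∈ P, (∑ i, p i) = 1 ∧ ∀ i, 0 ≤ p i)
    -- smooth setting: each `f_i` convex differentiable with `L_i`-Lipschitz gradient
    (fi : Fin m → EuclideanSpace ℝ (Fin n) → ℝ)
    (hficv : ∀ i, ConvexOn ℝ Set.univ (fi i))
    (hfidiff : ∀ i, Differentiable ℝ (fi i))
    (Li : Fin m → ℝ)
    (hLi : ∀ i, ∀ x y : EuclideanSpace ℝ (Fin n),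
      ‖gradient (fi i) x - gradient (fi i) y‖ ≤ Li i * ‖x - y‖)
    -- `f_i*` is the Fenchel conjugate of `f_i` (characterized here at gradient points,
    -- the only points where it is evaluated)
    (fistar : (i : Fin m) → EuclideanSpace ℝ (Fin n) → ℝ)
    (hfistar : ∀ i, ∀ z : EuclideanSpace ℝ (Fin n),
      IsLUB (Set.range fun y => ⟪gradient (fi i) z, y⟫ - fi i y)
        (fistar i (gradient (fi i) z)))
    -- `L_f = sup_{p ∈ P} L_p`, the aggregate smoothness constant
    (Lf : ℝ)
    (hLf : ∀ p ∈ P, ∀ x y : EuclideanSpace ℝ (Fin n),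
      ‖∑ i, p i • (gradient (fi i) x - gradient (fi i) y)‖ ≤ Lf * ‖x - y‖)
    (phat : Fin m → ℝ) (hphat : phat ∈ P)
    (x xbar : EuclideanSpace ℝ (Fin n)) :
    (1 / (2 * Lf)) * ‖∑ i, phat i • (gradient (fi i) x - gradient (fi i) xbar)‖ ^ 2
      ≤ ∑ i, phat i *
          (fistar i (gradient (fi i) x) - fistar i (gradient (fi i) xbar)
            - ⟪xbar, gradient (fi i) x - gradient (fi i) xbar⟫) := by
  have hfd : ∀ i z, HasFDerivAt (fi i) (innerSL ℝ (gradient (fi i) z)) z := by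
    intro i z
    exact ((hfidiff i z).hasGradientAt).hasFDerivAt
  have hst : ∀ i z, fistar i (gradient (fi i) z) = ⟪gradient (fi i) z, z⟫ - fi i z := by
    intro i z
    refine (hfistar i z).unique (IsGreatest.isLUB ⟨⟨z, rfl⟩, ?_⟩)
    rintro _ ⟨y, rfl⟩
    have := aux_convex (hficv i) (hfd i z) y
    rw [inner_sub_right] at this
    simp only
    linarith
  have hW : ∀ i, fistar i (gradient (fi i) x) - fistar i (gradient (fi i) xbar)
            - ⟪xbar, gradient (fi i) x - gradient (fi i) xbar⟫
      = fi i xbar - fi i x - ⟪gradient (fi i) x, xbar - x⟫ := by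
    intro i
    rw [hst, hst, inner_sub_right, inner_sub_right, real_inner_comm xbar, real_inner_comm xbar]
    simp only [real_inner_comm]
    ring
  simp only [hW]
  have hp := (hPsub phat hphat).2
  set F : EuclideanSpace ℝ (Fin n) → ℝ := fun y => ∑ i, phat i * fi i y with hF
  set G : EuclideanSpace ℝ (Fin n) → EuclideanSpace ℝ (Fin n) :=
    fun y => ∑ i, phat i • gradient (fi i) y with hG
  have hFG : ∀ z, HasFDerivAt F (innerSL ℝ (G z)) z := by
    intro z
    have := HasFDerivAt.fun_sum (u := Finset.univ) fun i _ => (hfd i z).const_mul (phat i)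
    have he : innerSL ℝ (G z) = ∑ i, phat i • innerSL ℝ (gradient (fi i) z) := by
      ext w
      simp [hG, sum_inner, real_inner_smul_left]
    rw [he]
    exact this
  have hGs : ∀ y z, ∑ i, phat i • (gradient (fi i) y - gradient (fi i) z) = G y - G z := by
    intro y z
    simp [hG, smul_sub, Finset.sum_sub_distrib]
  have hGL : ∀ y z, ‖G y - G z‖ ≤ Lf * ‖y - z‖ := by
    intro y z
    rw [← hGs]
    exact hLf phat hphat y z
  have hlow : ∀ y, F x + ⟪G x, y - x⟫ ≤ F y := by
    intro y
    simp only [hF, hG, sum_inner, ← Finset.sum_add_distrib, real_inner_smul_left, ← mul_add]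
    exact Finset.sum_le_sum fun i _ =>
      mul_le_mul_of_nonneg_left (aux_convex (hficv i) (hfd i x) y) (hp i)
  have hR : ∑ i, phat i * (fi i xbar - fi i x - ⟪gradient (fi i) x, xbar - x⟫)
      = F xbar - F x - ⟪G x, xbar - x⟫ := by
    simp only [hF, hG, sum_inner, ← Finset.sum_sub_distrib, real_inner_smul_left, ← mul_sub]
  rw [hR, hGs]
  rcases le_or_gt Lf 0 with hL | hL
  · have h1 : 1 / (2 * Lf) ≤ 0 := one_div_nonpos.2 (by linarith)
    have h2 := mul_nonpos_of_nonpos_of_nonneg h1 (sq_nonneg ‖G x - G xbar‖)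
    linarith [hlow xbar]
  · have h1 := aux_descent hFG hGL xbar ((1 / Lf) • (G x - G xbar))
    have h2 := hlow (xbar + (1 / Lf) • (G x - G xbar))
    rw [add_sub_right_comm, inner_add_right] at h2
    have h3 : ⟪G x, (1 / Lf) • (G x - G xbar)⟫ - ⟪G xbar, (1 / Lf) • (G x - G xbar)⟫
        = 1 / Lf * ‖G x - G xbar‖ ^ 2 := by
      rw [← inner_sub_left, real_inner_smul_right, real_inner_self_eq_norm_sq]
    have h4 : Lf / 2 * ‖(1 / Lf) • (G x - G xbar)‖ ^ 2
        = 1 / (2 * Lf) * ‖G x - G xbar‖ ^ 2 := by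
      rw [norm_smul, Real.norm_of_nonneg (by positivity)]
      field_simp
    have h5 : 1 / Lf * ‖G x - G xbar‖ ^ 2 = 2 * (1 / (2 * Lf) * ‖G x - G xbar‖ ^ 2) := by
      field_simp
    linarith
end

section
/- DRAO rate for smooth convex problems (Theorem 3.1): in the smooth setting, run DRAO with stepsizes w_t = t, θ_t = (t−1)/t, τ_t = (t−1)/2, η_t = 2L_f/t. Then the ergodic iterate x̄^N := (Σ_{t=1}^N t·x^t)/(Σ_{t=1}^N t) satisfies f(x̄^N) − f(x*) ≤ 2L_f‖x⁰ − x*‖²/(N(N+1)) for every N ≥ 1, where x* is any minimizer of f over X. -/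
open RealInnerProductSpace

theorem drao_line {n : ℕ} (g : EuclideanSpace ℝ (Fin n) → ℝ) (hg : Differentiable ℝ g)
    (a d : EuclideanSpace ℝ (Fin n)) (s : ℝ) :
    HasDerivAt (fun r : ℝ => g (a + r • d)) ⟪gradient g (a + s • d), d⟫ s := by
  have h1 : HasDerivAt (fun r : ℝ => a + r • d) d s := by
    simpa using ((hasDerivAt_id s).smul_const d).const_add a
  have h2 := (hg (a + s • d)).hasFDerivAt.comp_hasDerivAt s h1
  rw [inner_gradient_left]
  exact h2

theorem drao_grad_ineq {n : ℕ} (g : EuclideanSpace ℝ (Fin n) → ℝ) (hg : Differentiable ℝ g)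
    (hc : ConvexOn ℝ Set.univ g) (a y : EuclideanSpace ℝ (Fin n)) :
    g a + ⟪gradient g a, y - a⟫ ≤ g y := by
  have hcl : ConvexOn ℝ Set.univ (fun r : ℝ => g (a + r • (y - a))) := by
    refine ⟨convex_univ, fun r _ s _ c e hc0 he0 hce => ?_⟩
    have := hc.2 (Set.mem_univ (a + r • (y - a))) (Set.mem_univ (a + s • (y - a))) hc0 he0 hce
    have e2 : c • (a + r • (y - a)) + e • (a + s • (y - a)) = a + (c • r + e • s) • (y - a) := by
      obtain rfl : e = 1 - c := by linarith
      simp only [smul_eq_mul]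
      module
    rw [e2] at this
    exact this
  have h := hcl.le_slope_of_hasDerivAt (Set.mem_univ 0) (Set.mem_univ 1) one_pos
    (drao_line g hg a (y - a) 0)
  rw [slope_def_field] at h
  have e1 : a + (1 : ℝ) • (y - a) = y := by module
  have e0 : a + (0 : ℝ) • (y - a) = a := by module
  simp only [e1, e0] at h
  linarith

theorem drao_descent {n m : ℕ} (fi : Fin m → EuclideanSpace ℝ (Fin n) → ℝ)
    (hfidiff : ∀ i, Differentiable ℝ (fi i)) (L : ℝ) (p : Fin m → ℝ)
    (hL : ∀ x y : EuclideanSpace ℝ (Fin n),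
      ‖∑ i, p i • (gradient (fi i) x - gradient (fi i) y)‖ ≤ L * ‖x - y‖)
    (a y : EuclideanSpace ℝ (Fin n)) :
    ∑ i, p i * fi i y ≤ (∑ i, p i * (fi i a + ⟪gradient (fi i) a, y - a⟫))
      + L / 2 * ‖y - a‖ ^ 2 := by
  set d := y - a with hd
  have hder : ∀ s : ℝ, HasDerivAt (fun r : ℝ => (∑ i, p i * fi i (a + r • d))
      - r * (∑ i, p i * ⟪gradient (fi i) a, d⟫) - L / 2 * ‖d‖ ^ 2 * r ^ 2)
      ((∑ i, p i * ⟪gradient (fi i) (a + s • d), d⟫)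
        - 1 * (∑ i, p i * ⟪gradient (fi i) a, d⟫) - L / 2 * ‖d‖ ^ 2 * (2 * s)) s := by
    intro s
    refine HasDerivAt.sub (HasDerivAt.sub ?_ ?_) ?_
    · exact HasDerivAt.fun_sum fun i _ => (drao_line (fi i) (hfidiff i) a d s).const_mul (p i)
    · exact (hasDerivAt_id s).mul_const _
    · simpa using (hasDerivAt_pow 2 s).const_mul (L / 2 * ‖d‖ ^ 2)
  have hanti : AntitoneOn (fun r : ℝ => (∑ i, p i * fi i (a + r • d))
      - r * (∑ i, p i * ⟪gradient (fi i) a, d⟫) - L / 2 * ‖d‖ ^ 2 * r ^ 2) (Set.Icc 0 1) := by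
    refine antitoneOn_of_deriv_nonpos (convex_Icc 0 1)
      (fun s _ => (hder s).continuousAt.continuousWithinAt)
      (fun s _ => (hder s).differentiableAt.differentiableWithinAt) ?_
    intro s hs
    rw [interior_Icc] at hs
    rw [(hder s).deriv]
    have e : (∑ i, p i * ⟪gradient (fi i) (a + s • d), d⟫)
        - (∑ i, p i * ⟪gradient (fi i) a, d⟫)
        = ⟪∑ i, p i • (gradient (fi i) (a + s • d) - gradient (fi i) a), d⟫ := by
      rw [sum_inner, ← Finset.sum_sub_distrib]
      refine Finset.sum_congr rfl fun i _ => ?_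
      rw [real_inner_smul_left, inner_sub_left]; ring
    have h1 := real_inner_le_norm
      (∑ i, p i • (gradient (fi i) (a + s • d) - gradient (fi i) a)) d
    have h2 := hL (a + s • d) a
    rw [add_sub_cancel_left, norm_smul, Real.norm_of_nonneg hs.1.le] at h2
    have h3 := mul_le_mul_of_nonneg_right h2 (norm_nonneg d)
    nlinarith
  have h := hanti (Set.left_mem_Icc.2 zero_le_one) (Set.right_mem_Icc.2 zero_le_one) zero_le_one
  have hy : a + d = y := by rw [hd]; abel
  simp only [one_smul, zero_smul, add_zero, hy] at h
  simp only [mul_add, Finset.sum_add_distrib]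
  linarith

theorem drao_prox {n : ℕ} (X : Set (EuclideanSpace ℝ (Fin n))) (hX : Convex ℝ X)
    (φ : EuclideanSpace ℝ (Fin n) → ℝ) (hφ : ConvexOn ℝ Set.univ φ) (c : ℝ)
    (z a y : EuclideanSpace ℝ (Fin n)) (ha : a ∈ X) (hy : y ∈ X)
    (hmin : ∀ w ∈ X, φ a + c * ‖a - z‖ ^ 2 ≤ φ w + c * ‖w - z‖ ^ 2) :
    φ a + c * ‖a - z‖ ^ 2 + c * ‖y - a‖ ^ 2 ≤ φ y + c * ‖y - z‖ ^ 2 := by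
  have key : ∀ s ∈ Set.Ioo (0 : ℝ) 1,
      φ a + c * ‖a - z‖ ^ 2 + c * (1 - s) * ‖y - a‖ ^ 2 ≤ φ y + c * ‖y - z‖ ^ 2 := by
    intro s hs
    have h1 := hmin _ (hX ha hy (sub_nonneg.2 hs.2.le) hs.1.le (by ring))
    have h2 := hφ.2 (Set.mem_univ a) (Set.mem_univ y) (sub_nonneg.2 hs.2.le) hs.1.le (by ring)
    have e : ‖((1 - s) • a + s • y) - z‖ ^ 2
        = (1 - s) * ‖a - z‖ ^ 2 + s * ‖y - z‖ ^ 2 - s * (1 - s) * ‖y - a‖ ^ 2 := by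
      have e1 : ((1 - s) • a + s • y) - z = (a - z) + s • ((y - z) - (a - z)) := by module
      have e2 : y - a = (y - z) - (a - z) := by abel
      rw [e1, e2]
      generalize y - z = v
      generalize a - z = w
      rw [norm_add_sq_real, norm_smul, mul_pow, norm_sub_sq_real, real_inner_smul_right,
        inner_sub_right, real_inner_self_eq_norm_sq, real_inner_comm w v, Real.norm_eq_abs, sq_abs]
      ring
    rw [e] at h1
    simp only [smul_eq_mul] at h2
    have h3 : s * (φ a + c * ‖a - z‖ ^ 2 + c * (1 - s) * ‖y - a‖ ^ 2)
        ≤ s * (φ y + c * ‖y - z‖ ^ 2) := by nlinarith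
    exact le_of_mul_le_mul_left h3 hs.1
  have ht : Filter.Tendsto (fun s : ℝ => φ a + c * ‖a - z‖ ^ 2 + c * (1 - s) * ‖y - a‖ ^ 2)
      (nhdsWithin 0 (Set.Ioi 0)) (nhds (φ a + c * ‖a - z‖ ^ 2 + c * (1 - 0) * ‖y - a‖ ^ 2)) := by
    refine Filter.Tendsto.mono_left (Continuous.tendsto (by fun_prop) 0) nhdsWithin_le_nhds
  have := le_of_tendsto ht (Filter.mem_of_superset (Ioo_mem_nhdsGT one_pos) key)
  simpa using this

/-- One step, with everything expressed abstractly. -/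
theorem drao_step {n m : ℕ}
    (X : Set (EuclideanSpace ℝ (Fin n))) (hXcv : Convex ℝ X)
    (P : Set (Fin m → ℝ)) (hPne : P.Nonempty)
    (hPsub : ∀ p ∈ P, (∑ i, p i) = 1 ∧ ∀ i, 0 ≤ p i)
    (u : EuclideanSpace ℝ (Fin n) → ℝ) (hucv : ConvexOn ℝ Set.univ u)
    (ρstar : (Fin m → ℝ) → ℝ)
    (fi : Fin m → EuclideanSpace ℝ (Fin n) → ℝ)
    (hficv : ∀ i, ConvexOn ℝ Set.univ (fi i))
    (hfidiff : ∀ i, Differentiable ℝ (fi i))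
    (Lf : ℝ) (hLfpos : 0 < Lf)
    (hLf : ∀ p ∈ P, ∀ x y : EuclideanSpace ℝ (Fin n),
      ‖∑ i, p i • (gradient (fi i) x - gradient (fi i) y)‖ ≤ Lf * ‖x - y‖)
    (f : EuclideanSpace ℝ (Fin n) → ℝ)
    (hf : ∀ xx, IsLUB ((fun p => (∑ i, p i * fi i xx) - ρstar p) '' P) (f xx - u xx))
    (xs : EuclideanSpace ℝ (Fin n)) (hxs : xs ∈ X)
    (xb x0 x1 z : EuclideanSpace ℝ (Fin n)) (α c : ℝ) (hα0 : 0 ≤ α) (hα1 : α ≤ 1)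
    (hαc : Lf * α / 2 ≤ c)
    (hz : z = (1 - α) • xb + α • x0) (hx1 : x1 ∈ X)
    (hmin : IsMinOn (fun xx =>
        sSup ((fun p =>
          (∑ i, p i * (fi i z + ⟪gradient (fi i) z, xx - z⟫))
            - ρstar p) '' P)
        + u xx + c * ‖xx - x0‖ ^ 2) X x1) :
    f ((1 - α) • xb + α • x1) ≤ (1 - α) * f xb
      + α * (f xs + c * ‖x0 - xs‖ ^ 2 - c * ‖x1 - xs‖ ^ 2) := by
  have hle : ∀ p ∈ P, ∀ y, (∑ i, p i * (fi i z + ⟪gradient (fi i) z, y - z⟫)) - ρstar p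
      ≤ f y - u y := by
    intro p hp y
    refine le_trans ?_ ((hf y).1 ⟨p, hp, rfl⟩)
    refine sub_le_sub_right (Finset.sum_le_sum fun i _ => ?_) _
    exact mul_le_mul_of_nonneg_left (drao_grad_ineq (fi i) (hfidiff i) (hficv i) z y)
      ((hPsub p hp).2 i)
  set h : EuclideanSpace ℝ (Fin n) → ℝ := fun xx => sSup ((fun p =>
          (∑ i, p i * (fi i z + ⟪gradient (fi i) z, xx - z⟫)) - ρstar p) '' P) with hh
  have hbdd : ∀ y, BddAbove ((fun p =>
          (∑ i, p i * (fi i z + ⟪gradient (fi i) z, y - z⟫)) - ρstar p) '' P) := by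
    intro y
    refine ⟨f y - u y, ?_⟩
    rintro _ ⟨p, hp, rfl⟩
    exact hle p hp y
  have hlb : ∀ p ∈ P, ∀ y, (∑ i, p i * (fi i z + ⟪gradient (fi i) z, y - z⟫)) - ρstar p
      ≤ h y := fun p hp y => le_csSup (hbdd y) ⟨p, hp, rfl⟩
  have hub : ∀ y B, (∀ p ∈ P, (∑ i, p i * (fi i z + ⟪gradient (fi i) z, y - z⟫)) - ρstar p ≤ B) →
      h y ≤ B := by
    intro y B hB
    refine csSup_le (hPne.image _) ?_
    rintro _ ⟨p, hp, rfl⟩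
    exact hB p hp
  have haff : ∀ p : Fin m → ℝ, ∀ y w : EuclideanSpace ℝ (Fin n), ∀ a b : ℝ, a + b = 1 →
      (∑ i, p i * (fi i z + ⟪gradient (fi i) z, (a • y + b • w) - z⟫)) - ρstar p
      = a * ((∑ i, p i * (fi i z + ⟪gradient (fi i) z, y - z⟫)) - ρstar p)
        + b * ((∑ i, p i * (fi i z + ⟪gradient (fi i) z, w - z⟫)) - ρstar p) := by
    intro p y w a b hab
    have hb : b = 1 - a := by linarith
    subst hb
    have : ∀ i, p i * (fi i z + ⟪gradient (fi i) z, (a • y + (1 - a) • w) - z⟫)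
        = a * (p i * (fi i z + ⟪gradient (fi i) z, y - z⟫))
          + (1 - a) * (p i * (fi i z + ⟪gradient (fi i) z, w - z⟫)) := by
      intro i
      simp only [inner_sub_right, inner_add_right, real_inner_smul_right]
      ring
    simp only [this, Finset.sum_add_distrib, ← Finset.mul_sum]
    ring
  have hcv : ConvexOn ℝ Set.univ h := by
    refine ⟨convex_univ, fun y _ w _ a b ha hb hab => ?_⟩
    refine hub _ _ fun p hp => ?_
    rw [haff p y w a b hab]
    exact add_le_add (mul_le_mul_of_nonneg_left (hlb p hp y) ha)
      (mul_le_mul_of_nonneg_left (hlb p hp w) hb)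
  have hprox := drao_prox X hXcv (h + u) (hcv.add hucv) c x0 x1 xs hx1 hxs
    (fun w hw => hmin hw)
  simp only [Pi.add_apply] at hprox
  have hxsle : h xs ≤ f xs - u xs := hub _ _ fun p hp => hle p hp xs
  have hd : ((1 - α) • xb + α • x1) - z = α • (x1 - x0) := by rw [hz]; module
  have hstep : f ((1 - α) • xb + α • x1) - u ((1 - α) • xb + α • x1)
      ≤ (1 - α) * (f xb - u xb) + α * h x1 + Lf / 2 * (α ^ 2 * ‖x1 - x0‖ ^ 2) := by
    refine (hf _).2 ?_
    rintro _ ⟨p, hp, rfl⟩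
    have h1 := drao_descent fi hfidiff Lf p (hLf p hp) z ((1 - α) • xb + α • x1)
    have h2 := haff p xb x1 (1 - α) α (by ring)
    have h3 := mul_le_mul_of_nonneg_left (hle p hp xb) (sub_nonneg.2 hα1)
    have h4 := mul_le_mul_of_nonneg_left (hlb p hp x1) hα0
    have h5 : ‖((1 - α) • xb + α • x1) - z‖ ^ 2 = α ^ 2 * ‖x1 - x0‖ ^ 2 := by
      rw [hd, norm_smul, mul_pow, Real.norm_eq_abs, sq_abs]
    rw [h5] at h1
    simp only
    linarith
  have hu := hucv.2 (Set.mem_univ xb) (Set.mem_univ x1) (sub_nonneg.2 hα1) hα0 (by ring)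
  simp only [smul_eq_mul] at hu
  have hq := mul_le_mul_of_nonneg_right hαc (mul_nonneg hα0 (sq_nonneg ‖x1 - x0‖))
  have hp2 := mul_le_mul_of_nonneg_left (hprox.trans (add_le_add_left
    (add_le_add_left hxsle _) _)) hα0
  rw [norm_sub_rev x0 xs, norm_sub_rev x1 xs]
  nlinarith

/-- **DRAO rate for smooth convex problems** (Theorem 3.1):
with `w_t = t`, `θ_t = (t−1)/t`, `τ_t = (t−1)/2`, `η_t = 2L_f/t`, the ergodic iterate
`x̄^N = (∑_{t=1}^N t x^t)/(∑_{t=1}^N t)` satisfies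
`f(x̄^N) − f(x*) ≤ 2 L_f ‖x⁰ − x*‖² / (N(N+1))` for all `N ≥ 1`. -/
theorem DRAO_smooth_convex_rate
    (n m : ℕ) (hm : 1 ≤ m)
    (X : Set (EuclideanSpace ℝ (Fin n)))
    (hXne : X.Nonempty) (hXcl : IsClosed X) (hXcv : Convex ℝ X)
    (P : Set (Fin m → ℝ))
    (hPne : P.Nonempty) (hPcl : IsClosed P) (hPcv : Convex ℝ P)
    (hPsub : ∀ p ∈ P, (∑ i, p i) = 1 ∧ ∀ i, 0 ≤ p i)
    (u : EuclideanSpace ℝ (Fin n) → ℝ) (hucv : ConvexOn ℝ Set.univ u)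
    (ρstar : (Fin m → ℝ) → ℝ)
    (hρcv : ConvexOn ℝ Set.univ ρstar) (hρlsc : LowerSemicontinuous ρstar)
    -- smooth setting: each `f_i` convex differentiable with `L_i`-Lipschitz gradient
    (fi : Fin m → EuclideanSpace ℝ (Fin n) → ℝ)
    (hficv : ∀ i, ConvexOn ℝ Set.univ (fi i))
    (hfidiff : ∀ i, Differentiable ℝ (fi i))
    (Li : Fin m → ℝ)
    (hLi : ∀ i, ∀ x y : EuclideanSpace ℝ (Fin n),
      ‖gradient (fi i) x - gradient (fi i) y‖ ≤ Li i * ‖x - y‖)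
    -- `L_f = sup_{p∈P} L_p`, the aggregate smoothness constant
    (Lf : ℝ) (hLfpos : 0 < Lf)
    (hLf : ∀ p ∈ P, ∀ x y : EuclideanSpace ℝ (Fin n),
      ‖∑ i, p i • (gradient (fi i) x - gradient (fi i) y)‖ ≤ Lf * ‖x - y‖)
    -- the objective `f` and a minimizer `x*` of `f` over `X`
    (f : EuclideanSpace ℝ (Fin n) → ℝ)
    (hf : ∀ xx, IsLUB ((fun p => (∑ i, p i * fi i xx) - ρstar p) '' P) (f xx - u xx))
    (xstar : EuclideanSpace ℝ (Fin n)) (hxstarX : xstar ∈ X) (hxstar : IsMinOn f X xstar)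
    -- DRAO iterates (convention `x⁻¹ = x⁰` via `ℕ`-subtraction), with
    -- `θ_t = (t−1)/t`, `τ_t = (t−1)/2`, `η_t = 2 L_f / t`
    (x : ℕ → EuclideanSpace ℝ (Fin n)) (hx0 : x 0 ∈ X)
    (xund : ℕ → EuclideanSpace ℝ (Fin n)) (hxund0 : xund 0 = x 0)
    (hxund : ∀ t : ℕ, 1 ≤ t →
      xund t = (1 + ((t : ℝ) - 1) / 2)⁻¹ •
        ((x (t-1) + (((t : ℝ) - 1) / (t : ℝ)) • (x (t-1) - x (t-2)))
          + (((t : ℝ) - 1) / 2) • xund (t-1)))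
    (hxupd : ∀ t : ℕ, 1 ≤ t → x t ∈ X ∧
      IsMinOn (fun xx =>
        sSup ((fun p =>
          (∑ i, p i * (fi i (xund t) + ⟪gradient (fi i) (xund t), xx - xund t⟫))
            - ρstar p) '' P)
        + u xx + (2 * Lf / (t : ℝ)) / 2 * ‖xx - x (t-1)‖ ^ 2) X (x t)) :
    ∀ N : ℕ, 1 ≤ N →
      f ((∑ t ∈ Finset.Icc 1 N, (t : ℝ))⁻¹ • ∑ t ∈ Finset.Icc 1 N, (t : ℝ) • x t) - f xstar
        ≤ 2 * Lf * ‖x 0 - xstar‖ ^ 2 / ((N : ℝ) * ((N : ℝ) + 1)) := by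
  intro N _
  set S : ℕ → EuclideanSpace ℝ (Fin n) := fun t => ∑ s ∈ Finset.Icc 1 t, (s : ℝ) • x s with hS
  have hSs : ∀ t, S (t + 1) = S t + ((t : ℝ) + 1) • x (t + 1) := by
    intro t
    simp only [hS]
    rw [Finset.sum_Icc_succ_top (by omega)]
    push_cast
    rfl
  have hW : ∀ t : ℕ, ∑ s ∈ Finset.Icc 1 t, (s : ℝ) = (t : ℝ) * (t + 1) / 2 := by
    intro t
    induction t with
    | zero => simp
    | succ k ih => rw [Finset.sum_Icc_succ_top (by omega), ih]; push_cast; ring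
  -- closed form of the extrapolated points
  have hund : ∀ t : ℕ, (((t : ℝ) + 1) * (t + 2) / 2) • xund (t + 1)
      = S t + ((t : ℝ) + 1) • x t := by
    intro t
    induction t with
    | zero =>
      rw [hxund 1 le_rfl]
      simp [hS]
    | succ k ih =>
      rw [hxund (k + 1 + 1) (by omega)]
      have e1 : k + 1 + 1 - 1 = k + 1 := by omega
      have e2 : k + 1 + 1 - 2 = k := by omega
      rw [e1, e2, hSs, smul_smul]
      push_cast
      have hk : (0 : ℝ) ≤ k := Nat.cast_nonneg k
      have e3 : ((k : ℝ) + 1 + 1) * (k + 1 + 2) / 2 * (1 + ((k : ℝ) + 1 + 1 - 1) / 2)⁻¹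
          = (k : ℝ) + 2 := by
        have : 1 + ((k : ℝ) + 1 + 1 - 1) / 2 = ((k : ℝ) + 3) / 2 := by ring
        rw [this]
        field_simp
        ring
      rw [e3, smul_add, smul_smul]
      have e4 : ((k : ℝ) + 2) * (((k : ℝ) + 1 + 1 - 1) / 2) = ((k : ℝ) + 1) * (k + 2) / 2 := by
        ring
      rw [e4, ih, smul_add, smul_smul]
      have e5 : ((k : ℝ) + 2) * (((k : ℝ) + 1 + 1 - 1) / ((k : ℝ) + 1 + 1)) = k + 1 := by
        field_simp
        ring
      rw [e5]
      module
  have main : ∀ t : ℕ, ((t : ℝ) * (t + 1) / 2) * (f (((t : ℝ) * (t + 1) / 2)⁻¹ • S t) - f xstar)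
      + Lf * ‖x t - xstar‖ ^ 2 ≤ Lf * ‖x 0 - xstar‖ ^ 2 := by
    intro t
    induction t with
    | zero => simp
    | succ k ih =>
      have hk : (0 : ℝ) ≤ k := Nat.cast_nonneg k
      have hk2 : (0 : ℝ) < (k : ℝ) + 2 := by linarith
      have hk1 : (0 : ℝ) < (k : ℝ) + 1 := by linarith
      set xb := ((k : ℝ) * (k + 1) / 2)⁻¹ • S k with hxb
      have hSk : S k = ((k : ℝ) * (k + 1) / 2) • xb := by
        rcases Nat.eq_zero_or_pos k with h0 | h0
        · subst h0; simp [hS]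
        · have : (0 : ℝ) < k := Nat.cast_pos.2 h0
          rw [hxb, smul_smul, mul_inv_cancel₀ (by positivity), one_smul]
      clear_value xb
      have hcomb : ∀ w : EuclideanSpace ℝ (Fin n),
          (((k : ℝ) + 1) * (k + 2) / 2)⁻¹ • (S k + ((k : ℝ) + 1) • w)
            = (1 - 2 / ((k : ℝ) + 2)) • xb + (2 / ((k : ℝ) + 2)) • w := by
        intro w
        rw [hSk, smul_add, smul_smul, smul_smul]
        congr 2
        · field_simp
          ring
        · field_simp
      obtain ⟨hx1, hmin⟩ := hxupd (k + 1) (by omega)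
      have e1 : k + 1 - 1 = k := by omega
      rw [e1] at hmin
      have hz : xund (k + 1) = (1 - 2 / ((k : ℝ) + 2)) • xb + (2 / ((k : ℝ) + 2)) • x k := by
        rw [← hcomb, ← hund, smul_smul, inv_mul_cancel₀ (by positivity), one_smul]
      have hst := drao_step X hXcv P hPne hPsub u hucv ρstar fi hficv hfidiff Lf hLfpos hLf f hf
        xstar hxstarX xb (x k) (x (k + 1)) (xund (k + 1)) (2 / ((k : ℝ) + 2))
        ((2 * Lf / ((k + 1 : ℕ) : ℝ)) / 2) (by positivity)
        (by rw [div_le_one hk2]; linarith)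
        (by
          push_cast
          have : 2 / ((k : ℝ) + 2) ≤ 2 / ((k : ℝ) + 1) := by gcongr; linarith
          have h2 := mul_le_mul_of_nonneg_left this hLfpos.le
          calc _ ≤ Lf * (2 / ((k : ℝ) + 1)) / 2 := by linarith
            _ = _ := by ring)
        hz hx1 hmin
      rw [← hcomb, ← hSs] at hst
      push_cast at hst ⊢
      have e3 : (k : ℝ) + 1 + 1 = k + 2 := by ring
      rw [e3]
      set F := f ((((k : ℝ) + 1) * (k + 2) / 2)⁻¹ • S (k + 1))
      have h4 := mul_le_mul_of_nonneg_left hst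
        (show (0 : ℝ) ≤ ((k : ℝ) + 1) * (k + 2) / 2 by positivity)
      have e5 : ((k : ℝ) + 1) * (k + 2) / 2 * ((1 - 2 / ((k : ℝ) + 2)) * f xb
          + 2 / ((k : ℝ) + 2) * (f xstar + 2 * Lf / ((k : ℝ) + 1) / 2 * ‖x k - xstar‖ ^ 2
            - 2 * Lf / ((k : ℝ) + 1) / 2 * ‖x (k + 1) - xstar‖ ^ 2))
          = (k : ℝ) * (k + 1) / 2 * f xb + (k + 1) * f xstar + Lf * ‖x k - xstar‖ ^ 2
            - Lf * ‖x (k + 1) - xstar‖ ^ 2 := by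
        field_simp
        ring
      rw [e5] at h4
      nlinarith
  have hm := main N
  have hN : (0 : ℝ) < N := Nat.cast_pos.2 (by omega)
  rw [hW, le_div_iff₀ (by positivity)]
  have := mul_nonneg hLfpos.le (sq_nonneg ‖x N - xstar‖)
  simp only [hS] at hm
  nlinarith
end

section
/- DRAO rate for structured nonsmooth convex problems (Theorem 3.3(a)): with each Π_i bounded, run DRAO with V_i(π; π̄) = (1/2)‖π − π̄‖², i.e. π_i^t ∈ argmax_{π_i∈Π_i} ⟨A_ix̃^t, π_i⟩ − f_i*(π_i) − (τ_t/2)‖π_i − π_i^{t−1}‖², and stepsizes w_t = 1, θ_t = 1, η_t = M_A D_Π / R₀, τ_t = M_A R₀ / D_Π, where M_A := max_i ‖A_i‖_{2,2}, D_Π := max_i sup_{π,π̄∈Π_i} ‖π − π̄‖ and R₀ ≥ ‖x⁰ − x*‖. Then the ergodic iterate x̄^N := (1/N)Σ_{t=1}^N x^t satisfies f(x̄^N) − f(x*) ≤ M_A D_Π R₀ / N for every N ≥ 1. -/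
open RealInnerProductSpace


lemma three_point {E : Type*} [NormedAddCommGroup E] [InnerProductSpace ℝ E] {S : Set E}
    {φ : E → ℝ} (hφ : ConvexOn ℝ S φ) (c : ℝ) {y z w : E} (hz : z ∈ S) (hw : w ∈ S)
    (hmin : ∀ v ∈ S, φ z + c / 2 * ‖z - y‖ ^ 2 ≤ φ v + c / 2 * ‖v - y‖ ^ 2) :
    φ z + c / 2 * ‖z - y‖ ^ 2 + c / 2 * ‖w - z‖ ^ 2 ≤ φ w + c / 2 * ‖w - y‖ ^ 2 := by
  have key : ∀ s : ℝ, 0 < s → s < 1 → (1 - s) * (c / 2 * ‖w - z‖ ^ 2) ≤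
      φ w + c / 2 * ‖w - y‖ ^ 2 - (φ z + c / 2 * ‖z - y‖ ^ 2) := by
    intro s hs hs1
    have h1 := hφ.2 hz hw (by linarith : 0 ≤ 1 - s) hs.le (by ring)
    have h2 := hmin _ (hφ.1 hz hw (by linarith : 0 ≤ 1 - s) hs.le (by ring))
    have h3 : ‖(1 - s) • z + s • w - y‖ ^ 2 =
        (1 - s) * ‖z - y‖ ^ 2 + s * ‖w - y‖ ^ 2 - s * (1 - s) * ‖w - z‖ ^ 2 := by
      have e1 : (1 - s) • z + s • w - y = (1 - s) • (z - y) + s • (w - y) := by module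
      have e2 : w - z = (w - y) - (z - y) := by abel
      rw [e1, e2, norm_add_sq_real, norm_sub_sq_real (w - y) (z - y), norm_smul, norm_smul, mul_pow, mul_pow,
        Real.norm_eq_abs, Real.norm_eq_abs, sq_abs, sq_abs, real_inner_smul_left,
        real_inner_smul_right, real_inner_comm (z - y) (w - y)]
      ring
    rw [h3] at h2
    simp only [smul_eq_mul] at h1
    refine le_of_mul_le_mul_left ?_ hs
    linarith
  have hK : 0 ≤ ‖w - z‖ ^ 2 := sq_nonneg _
  have ht : Filter.Tendsto (fun s : ℝ => (1 - s) * (c / 2 * ‖w - z‖ ^ 2))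
      (nhdsWithin 0 (Set.Ioi 0)) (nhds ((1 - 0) * (c / 2 * ‖w - z‖ ^ 2))) := by
    apply Filter.Tendsto.mono_left _ nhdsWithin_le_nhds
    exact Continuous.tendsto (by fun_prop) 0
  have := le_of_tendsto ht (by
    filter_upwards [Ioo_mem_nhdsGT (show (0:ℝ) < 1 by norm_num)] with s hs
    exact key s hs.1 hs.2)
  linarith

lemma young {M τ η a b : ℝ} (hτ : 0 < τ) (h : M ^ 2 = τ * η) :
    M * a * b ≤ τ / 2 * b ^ 2 + η / 2 * a ^ 2 := by
  have : 0 ≤ (τ * b - M * a) ^ 2 := sq_nonneg _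
  have h2 : (τ * b - M * a) ^ 2 = 2 * τ * (τ / 2 * b ^ 2 + η / 2 * a ^ 2 - M * a * b) := by
    have : (τ * b - M * a) ^ 2 = τ ^ 2 * b ^ 2 - 2 * τ * b * M * a + M ^ 2 * a ^ 2 := by ring
    rw [this, h]; ring
  rw [h2] at this
  have := nonneg_of_mul_nonneg_right this (by linarith)
  linarith

/-- Telescoped dual error bound for a single scenario. -/
lemma dual_bound {E F : Type*} [NormedAddCommGroup E] [InnerProductSpace ℝ E]
    [NormedAddCommGroup F] [InnerProductSpace ℝ F] (A : E →L[ℝ] F) {S : Set F}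
    {φ : F → ℝ} (hφ : ConvexOn ℝ S φ) (M τ η D : ℝ) (hτ : 0 < τ) (h : M ^ 2 = τ * η)
    (hA : ‖A‖ ≤ M) (hD : ∀ ξ ∈ S, ∀ ξ' ∈ S, ‖ξ - ξ'‖ ≤ D)
    (x : ℕ → E) (q : ℕ → F) (hq : ∀ t, q t ∈ S)
    (hmax : ∀ t, ∀ v ∈ S, ⟪A (x t + (1 : ℝ) • (x t - x (t - 1))), v⟫ - φ v
        - τ / 2 * ‖v - q t‖ ^ 2 ≤
      ⟪A (x t + (1 : ℝ) • (x t - x (t - 1))), q (t + 1)⟫ - φ (q (t + 1))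
        - τ / 2 * ‖q (t + 1) - q t‖ ^ 2) {w : F} (hw : w ∈ S) (N : ℕ) :
    ∑ t ∈ Finset.range N, (⟪A (x (t + 1)), w⟫ - φ w) ≤
      ∑ t ∈ Finset.range N, (⟪A (x (t + 1)), q (t + 1)⟫ - φ (q (t + 1)))
      + τ / 2 * D ^ 2 + η / 2 * ∑ t ∈ Finset.range N, ‖x (t + 1) - x t‖ ^ 2 := by
  have cs : ∀ (a : E) (b : F), ⟪A a, b⟫ ≤ τ / 2 * ‖b‖ ^ 2 + η / 2 * ‖a‖ ^ 2 := by
    intro a b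
    calc ⟪A a, b⟫ ≤ ‖A a‖ * ‖b‖ := real_inner_le_norm _ _
      _ ≤ M * ‖a‖ * ‖b‖ := by
        gcongr
        exact (A.le_opNorm a).trans (by gcongr)
      _ ≤ _ := young hτ h
  have step : ∀ t, ⟪A (x (t + 1)), w⟫ - φ w - (⟪A (x (t + 1)), q (t + 1)⟫ - φ (q (t + 1))) ≤
      ⟪A (x (t + 1) - x t), w - q (t + 1)⟫ - ⟪A (x t - x (t - 1)), w - q t⟫
      + η / 2 * ‖x t - x (t - 1)‖ ^ 2
      + τ / 2 * ‖w - q t‖ ^ 2 - τ / 2 * ‖w - q (t + 1)‖ ^ 2 := by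
    intro t
    set xt := x t + (1 : ℝ) • (x t - x (t - 1)) with hxt
    have hcv : ConvexOn ℝ S (fun v => φ v + -⟪A xt, v⟫) := by
      refine hφ.add ⟨hφ.1, ?_⟩
      intro a _ b _ s r _ _ _
      simp only [inner_add_right, real_inner_smul_right, smul_eq_mul]
      linarith
    have h1 := three_point hcv τ (y := q t) (hq (t + 1)) hw (by
      intro v hv
      have := hmax t v hv
      linarith)
    have h2 := cs (x t - x (t - 1)) (q (t + 1) - q t)
    simp only [hxt, one_smul, map_add, map_sub, inner_add_left, inner_sub_left,
      inner_sub_right] at h1 h2 ⊢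
    linarith
  have tel : ∀ N, ∑ t ∈ Finset.range N, (⟪A (x (t + 1)), w⟫ - φ w) ≤
      ∑ t ∈ Finset.range N, (⟪A (x (t + 1)), q (t + 1)⟫ - φ (q (t + 1)))
      + τ / 2 * ‖w - q 0‖ ^ 2 - τ / 2 * ‖w - q N‖ ^ 2
      + ⟪A (x N - x (N - 1)), w - q N⟫ + η / 2 * ∑ t ∈ Finset.range N, ‖x (t + 1) - x t‖ ^ 2
      - η / 2 * ‖x N - x (N - 1)‖ ^ 2 := by
    intro N
    induction N with
    | zero => simp
    | succ k ih =>
      have := step k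
      simp only [Finset.sum_range_succ, Nat.add_sub_cancel, mul_add]
      linarith
  have h1 := tel N
  have h2 := cs (x N - x (N - 1)) (w - q N)
  have h3 : τ / 2 * ‖w - q 0‖ ^ 2 ≤ τ / 2 * D ^ 2 := by
    gcongr
    exact hD _ hw _ (hq 0)
  linarith

/-- **DRAO rate for structured nonsmooth convex problems** (Theorem 3.3(a)):
with `V_i(π;π̄) = ‖π − π̄‖²/2`, `w_t = 1`, `θ_t = 1`, `η_t = M_A D_Π / R₀`,
`τ_t = M_A R₀ / D_Π`, the ergodic iterate `x̄^N = (1/N) ∑_{t=1}^N x^t` satisfies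
`f(x̄^N) − f(x*) ≤ M_A D_Π R₀ / N` for all `N ≥ 1`. -/
theorem DRAO_nonsmooth_convex_rate
    (n m : ℕ) (hm : 1 ≤ m) (d : Fin m → ℕ)
    (X : Set (EuclideanSpace ℝ (Fin n)))
    (hXne : X.Nonempty) (hXcl : IsClosed X) (hXcv : Convex ℝ X)
    (P : Set (Fin m → ℝ))
    (hPne : P.Nonempty) (hPcl : IsClosed P) (hPcv : Convex ℝ P)
    (hPsub : ∀ p ∈ P, (∑ i, p i) = 1 ∧ ∀ i, 0 ≤ p i)
    (u : EuclideanSpace ℝ (Fin n) → ℝ) (hucv : ConvexOn ℝ Set.univ u)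
    -- each `Π_i` is nonempty compact convex
    (Pis : (i : Fin m) → Set (EuclideanSpace ℝ (Fin (d i))))
    (hPisne : ∀ i, (Pis i).Nonempty) (hPiscp : ∀ i, IsCompact (Pis i))
    (hPiscv : ∀ i, Convex ℝ (Pis i))
    (A : (i : Fin m) → EuclideanSpace ℝ (Fin n) →L[ℝ] EuclideanSpace ℝ (Fin (d i)))
    (fistar : (i : Fin m) → EuclideanSpace ℝ (Fin (d i)) → ℝ)
    (hfistarcv : ∀ i, ConvexOn ℝ Set.univ (fistar i))
    (hfistarlsc : ∀ i, LowerSemicontinuous (fistar i))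
    (ρstar : (Fin m → ℝ) → ℝ)
    (hρcv : ConvexOn ℝ Set.univ ρstar) (hρlsc : LowerSemicontinuous ρstar)
    -- scenario costs and objective
    (fi : Fin m → EuclideanSpace ℝ (Fin n) → ℝ)
    (hfi : ∀ i, ∀ xx : EuclideanSpace ℝ (Fin n),
      IsLUB ((fun πi => ⟪A i xx, πi⟫ - fistar i πi) '' Pis i) (fi i xx))
    (f : EuclideanSpace ℝ (Fin n) → ℝ)
    (hf : ∀ xx, IsLUB ((fun p => (∑ i, p i * fi i xx) - ρstar p) '' P) (f xx - u xx))
    (xstar : EuclideanSpace ℝ (Fin n)) (hxstarX : xstar ∈ X) (hxstar : IsMinOn f X xstar)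
    -- problem constants: `M_A ≥ max_i ‖A_i‖`, `D_Π ≥ diam Π_i`
    (MA DPi R0 : ℝ) (hMApos : 0 < MA) (hDPipos : 0 < DPi) (hR0pos : 0 < R0)
    (hMA : ∀ i, ‖A i‖ ≤ MA)
    (hDPi : ∀ i, ∀ ξ ∈ Pis i, ∀ ξ' ∈ Pis i, ‖ξ - ξ'‖ ≤ DPi)
    -- DRAO iterates (convention `x⁻¹ = x⁰` via `ℕ`-subtraction)
    (x : ℕ → EuclideanSpace ℝ (Fin n)) (hx0 : x 0 ∈ X)
    (hR0 : ‖x 0 - xstar‖ ≤ R0)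
    (π : ℕ → (i : Fin m) → EuclideanSpace ℝ (Fin (d i)))
    (hπ0 : ∀ i, π 0 i ∈ Pis i)
    (hπupd : ∀ t : ℕ, 1 ≤ t → ∀ i, π t i ∈ Pis i ∧
      IsMaxOn (fun ξ => ⟪A i (x (t-1) + (1 : ℝ) • (x (t-1) - x (t-2))), ξ⟫
        - fistar i ξ - (MA * R0 / DPi) / 2 * ‖ξ - π (t-1) i‖ ^ 2) (Pis i) (π t i))
    (hxupd : ∀ t : ℕ, 1 ≤ t → x t ∈ X ∧
      IsMinOn (fun xx =>
        sSup ((fun p => (∑ i, p i * (⟪A i xx, π t i⟫ - fistar i (π t i))) - ρstar p) '' P)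
          + u xx + (MA * DPi / R0) / 2 * ‖xx - x (t-1)‖ ^ 2) X (x t)) :
    ∀ N : ℕ, 1 ≤ N →
      f (((N : ℝ))⁻¹ • ∑ t ∈ Finset.Icc 1 N, x t) - f xstar ≤ MA * DPi * R0 / (N : ℝ) := by
  intro N hN
  have hNpos : (0 : ℝ) < N := by exact_mod_cast hN
  have hIcc : ∀ {G : Type} [AddCommMonoid G] (g : ℕ → G),
      ∑ t ∈ Finset.Icc 1 N, g t = ∑ t ∈ Finset.range N, g (t + 1) := by
    intro G _ g
    rw [← Finset.Ico_add_one_right_eq_Icc, Finset.sum_Ico_eq_sum_range]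
    simp [add_comm]
  rw [hIcc]
  set τ := MA * R0 / DPi with hτdef
  set η := MA * DPi / R0 with hηdef
  have hτ : 0 < τ := by positivity
  have hη : 0 < η := by positivity
  have hτη : MA ^ 2 = τ * η := by rw [hτdef, hηdef]; field_simp
  set xb := (N : ℝ)⁻¹ • ∑ t ∈ Finset.range N, x (t + 1) with hxb
  have hNxb : ∑ t ∈ Finset.range N, x (t + 1) = (N : ℝ) • xb := by
    rw [hxb, smul_smul, mul_inv_cancel₀ hNpos.ne', one_smul]
  have hπ : ∀ t i, π t i ∈ Pis i := by
    intro t i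
    rcases t with _ | t
    · exact hπ0 i
    · exact (hπupd (t + 1) (by omega) i).1
  set c : ℕ → Fin m → ℝ := fun t i => ⟪A i (x (t + 1)), π (t + 1) i⟫ - fistar i (π (t + 1) i)
    with hc
  set Δ := ∑ t ∈ Finset.range N, ‖x (t + 1) - x t‖ ^ 2 with hΔ
  set B := τ / 2 * DPi ^ 2 + η / 2 * Δ with hB
  -- dual part
  have hdual : ∀ i, N * fi i xb ≤ ∑ t ∈ Finset.range N, c t i + B := by
    intro i
    have : fi i xb ≤ (∑ t ∈ Finset.range N, c t i + B) / N := by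
      refine (hfi i xb).2 ?_
      rintro _ ⟨w, hw, rfl⟩
      rw [le_div_iff₀ hNpos]
      have hb := dual_bound (A i) ((hfistarcv i).subset (Set.subset_univ _) (hPiscv i))
        MA τ η DPi hτ hτη (hMA i) (hDPi i) x (fun t => π t i) (fun t => hπ t i)
        (fun t v hv => by
          have := (hπupd (t + 1) (by omega) i).2 hv
          simpa using this) hw N
      have e : ∑ t ∈ Finset.range N, (⟪A i (x (t + 1)), w⟫ - fistar i w)
          = (⟪A i xb, w⟫ - fistar i w) * N := by
        rw [Finset.sum_sub_distrib, ← sum_inner, ← map_sum, hNxb, map_smul,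
          real_inner_smul_left]
        simp
        ring
      rw [e] at hb
      simp only [hc, hB]
      linarith
    rw [le_div_iff₀ hNpos] at this
    linarith
  -- the model functions
  have hle : ∀ t xx, ∀ p ∈ P,
      (∑ i, p i * (⟪A i xx, π t i⟫ - fistar i (π t i))) - ρstar p ≤ f xx - u xx := by
    intro t xx p hp
    refine le_trans ?_ ((hf xx).1 ⟨p, hp, rfl⟩)
    refine sub_le_sub_right (Finset.sum_le_sum fun i _ => ?_) _
    exact mul_le_mul_of_nonneg_left ((hfi i xx).1 ⟨π t i, hπ t i, rfl⟩) ((hPsub p hp).2 i)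
  set h : ℕ → EuclideanSpace ℝ (Fin n) → ℝ := fun t xx =>
    sSup ((fun p => (∑ i, p i * (⟪A i xx, π t i⟫ - fistar i (π t i))) - ρstar p) '' P) with hh
  have hleh : ∀ t xx, ∀ p ∈ P,
      (∑ i, p i * (⟪A i xx, π t i⟫ - fistar i (π t i))) - ρstar p ≤ h t xx := by
    intro t xx p hp
    refine le_csSup ⟨f xx - u xx, ?_⟩ ⟨p, hp, rfl⟩
    rintro _ ⟨p, hp, rfl⟩
    exact hle t xx p hp
  have hhf : ∀ t xx, h t xx ≤ f xx - u xx := by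
    intro t xx
    refine csSup_le (hPne.image _) ?_
    rintro _ ⟨p, hp, rfl⟩
    exact hle t xx p hp
  have hhcv : ∀ t, ConvexOn ℝ X (h t) := by
    intro t
    refine ⟨hXcv, ?_⟩
    intro a _ b _ s r hs hr hsr
    refine csSup_le (hPne.image _) ?_
    rintro _ ⟨p, hp, rfl⟩
    have h1 := mul_le_mul_of_nonneg_left (hleh t a p hp) hs
    have h2 := mul_le_mul_of_nonneg_left (hleh t b p hp) hr
    simp only [smul_eq_mul]
    refine le_trans (le_of_eq ?_) (add_le_add h1 h2)
    have e : ∀ i, p i * (⟪A i (s • a + r • b), π t i⟫ - fistar i (π t i)) =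
        s * (p i * (⟪A i a, π t i⟫ - fistar i (π t i)))
        + r * (p i * (⟪A i b, π t i⟫ - fistar i (π t i))) := by
      intro i
      rw [map_add, map_smul, map_smul, inner_add_left, real_inner_smul_left,
        real_inner_smul_left]
      linear_combination (p i * fistar i (π t i)) * hsr
    simp only [e, Finset.sum_add_distrib, ← Finset.mul_sum]
    linear_combination (ρstar p) * hsr
  -- primal part
  have hprim : ∀ t, h (t + 1) (x (t + 1)) + u (x (t + 1)) + η / 2 * ‖x (t + 1) - x t‖ ^ 2
      + η / 2 * ‖xstar - x (t + 1)‖ ^ 2 ≤ f xstar + η / 2 * ‖xstar - x t‖ ^ 2 := by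
    intro t
    have hu := hxupd (t + 1) (by omega)
    have h1 := three_point ((hhcv (t + 1)).add (hucv.subset (Set.subset_univ _) hXcv)) η
      (y := x t) hu.1 hxstarX (fun v hv => by
        have := hu.2 hv
        simpa using this)
    have h2 := hhf (t + 1) xstar
    simp only [Pi.add_apply] at h1
    linarith
  have hprimsum : ∀ K, ∑ t ∈ Finset.range K, (h (t + 1) (x (t + 1)) + u (x (t + 1)))
      + η / 2 * ∑ t ∈ Finset.range K, ‖x (t + 1) - x t‖ ^ 2
      + η / 2 * ‖xstar - x K‖ ^ 2 ≤ K * f xstar + η / 2 * ‖xstar - x 0‖ ^ 2 := by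
    intro K
    induction K with
    | zero => simp
    | succ k ih =>
      have := hprim k
      simp only [Finset.sum_range_succ, mul_add]
      push_cast
      linarith
  have hp := hprimsum N
  rw [Finset.sum_add_distrib] at hp
  have hr : η / 2 * ‖xstar - x 0‖ ^ 2 ≤ η / 2 * R0 ^ 2 := by
    rw [norm_sub_rev]
    gcongr
  have hnn : 0 ≤ η / 2 * ‖xstar - x N‖ ^ 2 := by positivity
  -- Jensen for `u`
  have hju : N * u xb ≤ ∑ t ∈ Finset.range N, u (x (t + 1)) := by
    have := hucv.map_sum_le (t := Finset.range N) (w := fun _ => (N : ℝ)⁻¹)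
      (p := fun t => x (t + 1)) (fun _ _ => by positivity)
      (by simp [mul_inv_cancel₀ hNpos.ne']) (fun _ _ => Set.mem_univ _)
    rw [← Finset.smul_sum, ← Finset.smul_sum, ← hxb, smul_eq_mul, inv_mul_eq_div,
      le_div_iff₀ hNpos] at this
    linarith
  have hmain : f xb - u xb ≤ (∑ t ∈ Finset.range N, h (t + 1) (x (t + 1)) + B) / N := by
    refine (hf xb).2 ?_
    rintro _ ⟨p, hpP, rfl⟩
    rw [le_div_iff₀ hNpos]
    have h1 : ∑ i, p i * (N * fi i xb) ≤ ∑ i, p i * (∑ t ∈ Finset.range N, c t i + B) :=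
      Finset.sum_le_sum fun i _ => mul_le_mul_of_nonneg_left (hdual i) ((hPsub p hpP).2 i)
    have h2 : ∑ i, p i * (∑ t ∈ Finset.range N, c t i + B) =
        ∑ t ∈ Finset.range N, ∑ i, p i * c t i + B := by
      simp only [mul_add, Finset.sum_add_distrib]
      rw [← Finset.sum_mul, (hPsub p hpP).1, one_mul, Finset.sum_comm]
      simp only [Finset.mul_sum]
    have h3 : ∑ t ∈ Finset.range N, ((∑ i, p i * c t i) - ρstar p) ≤
        ∑ t ∈ Finset.range N, h (t + 1) (x (t + 1)) :=
      Finset.sum_le_sum fun t _ => hleh (t + 1) (x (t + 1)) p hpP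
    rw [Finset.sum_sub_distrib] at h3
    simp only [Finset.sum_const, Finset.card_range, nsmul_eq_mul] at h3
    have h4 : ∑ i, p i * (N * fi i xb) = (∑ i, p i * fi i xb) * N := by
      rw [Finset.sum_mul]
      exact Finset.sum_congr rfl fun i _ => by ring
    simp only [sub_mul]
    linarith
  rw [le_div_iff₀ hNpos] at hmain ⊢
  have hfin : τ / 2 * DPi ^ 2 + η / 2 * R0 ^ 2 = MA * DPi * R0 := by
    rw [hτdef, hηdef]; field_simp; ring
  simp only [hB] at hmain
  linarith
end

section
/- DRAO rate for structured nonsmooth strongly convex problems (Theorem 3.3(b)): with each Π_i bounded and u α-strongly convex (α > 0), run DRAO with V_i(π; π̄) = (1/2)‖π − π̄‖² and stepsizes w_t = t, θ_t = (t−1)/t, η_t = tα/3, τ_t = 3M_A²/(tα), where M_A := max_i ‖A_i‖_{2,2} and D_Π := max_i sup_{π,π̄∈Π_i} ‖π − π̄‖. Then the ergodic iterate x̄^N := (Σ_{t=1}^N t·x^t)/(Σ_{t=1}^N t) satisfies f(x̄^N) − f(x*) ≤ (α‖x⁰ − x*‖²/3 + 3M_A²D_Π²/α)/N² for every N ≥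 1. -/
open RealInnerProductSpace

theorem aux_prox {E : Type*} [NormedAddCommGroup E] [InnerProductSpace ℝ E]
    {S : Set E} (hS : Convex ℝ S) {μ η : ℝ} {φ : E → ℝ} (hφ : StrongConvexOn Set.univ μ φ)
    {y x z : E} (hx : x ∈ S) (hz : z ∈ S)
    (hmin : ∀ w ∈ S, φ x + η / 2 * ‖x - y‖ ^ 2 ≤ φ w + η / 2 * ‖w - y‖ ^ 2) :
    φ x + η / 2 * ‖x - y‖ ^ 2 + (μ + η) / 2 * ‖z - x‖ ^ 2 ≤ φ z + η / 2 * ‖z - y‖ ^ 2 := by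
  set K := (μ + η) / 2 * ‖z - x‖ ^ 2 with hK
  have key : ∀ s : ℝ, 0 < s → s < 1 →
      φ x + η / 2 * ‖x - y‖ ^ 2 + (1 - s) * K ≤ φ z + η / 2 * ‖z - y‖ ^ 2 := by
    intro s hs hs1
    have h1 := hmin ((1 - s) • x + s • z) (hS hx hz (by linarith) hs.le (by ring))
    have h2 := hφ.2 (Set.mem_univ x) (Set.mem_univ z) (by linarith : 0 ≤ 1 - s) hs.le (by ring)
    simp only [smul_eq_mul] at h2
    have h3 : ‖((1 - s) • x + s • z) - y‖ ^ 2
        = (1 - s) * ‖x - y‖ ^ 2 + s * ‖z - y‖ ^ 2 - s * (1 - s) * ‖z - x‖ ^ 2 := by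
      have e1 : ((1 - s) • x + s • z) - y = (x - y) + s • (z - x) := by module
      have e2 : z - y = (x - y) + (z - x) := by abel
      rw [e1, e2, norm_add_sq_real, norm_add_sq_real, norm_smul, inner_smul_right, mul_pow,
        Real.norm_eq_abs, sq_abs]
      ring
    rw [norm_sub_rev x z] at h2
    rw [h3] at h1
    have : s * (φ x + η / 2 * ‖x - y‖ ^ 2 + (1 - s) * K) ≤ s * (φ z + η / 2 * ‖z - y‖ ^ 2) := by
      rw [hK]; nlinarith
    exact le_of_mul_le_mul_left this hs
  have hlim : Filter.Tendsto (fun s : ℝ => φ x + η / 2 * ‖x - y‖ ^ 2 + (1 - s) * K)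
      (nhdsWithin 0 (Set.Ioi 0)) (nhds (φ x + η / 2 * ‖x - y‖ ^ 2 + (1 - 0) * K)) := by
    apply Filter.Tendsto.mono_left _ nhdsWithin_le_nhds
    apply Continuous.tendsto (f := fun s : ℝ => φ x + η / 2 * ‖x - y‖ ^ 2 + (1 - s) * K)
    fun_prop
  have := le_of_tendsto hlim (b := φ z + η / 2 * ‖z - y‖ ^ 2) (by
    filter_upwards [Ioo_mem_nhdsGT (show (0:ℝ) < 1 by norm_num)] with s hs
    exact key s hs.1 hs.2)
  linarith

/-- Cauchy-Schwarz plus Young with the DRAO constants. -/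
theorem aux_young {E F : Type*} [NormedAddCommGroup E] [InnerProductSpace ℝ E]
    [NormedAddCommGroup F] [InnerProductSpace ℝ F] (A : E →L[ℝ] F) {M α : ℝ} (hα : 0 < α)
    (hA : ‖A‖ ≤ M) (k : ℝ) (hk : 0 ≤ k) (v : E) (w : F) :
    k * ⟪A v, w⟫ ≤ k ^ 2 * α / 6 * ‖v‖ ^ 2 + 3 * M ^ 2 / α / 2 * ‖w‖ ^ 2 := by
  have h1 : ⟪A v, w⟫ ≤ M * ‖v‖ * ‖w‖ :=
    (real_inner_le_norm _ _).trans
      (mul_le_mul_of_nonneg_right ((A.le_opNorm v).trans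
        (mul_le_mul_of_nonneg_right hA (norm_nonneg _))) (norm_nonneg _))
  have h2 := mul_le_mul_of_nonneg_left h1 hk
  refine h2.trans ?_
  have h3 : k ^ 2 * α / 6 * ‖v‖ ^ 2 + 3 * M ^ 2 / α / 2 * ‖w‖ ^ 2 - k * (M * ‖v‖ * ‖w‖)
      = (k * α * ‖v‖ - 3 * M * ‖w‖) ^ 2 / (6 * α) := by
    field_simp
    ring
  have : 0 ≤ (k * α * ‖v‖ - 3 * M * ‖w‖) ^ 2 / (6 * α) := by positivity
  linarith

theorem aux_dual {E F : Type*} [NormedAddCommGroup E] [InnerProductSpace ℝ E]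
    [NormedAddCommGroup F] [InnerProductSpace ℝ F] (A : E →L[ℝ] F) {M α : ℝ} (hα : 0 < α)
    (hA : ‖A‖ ≤ M) {S : Set F} (hS : Convex ℝ S) {g : F → ℝ} (hg : ConvexOn ℝ Set.univ g)
    (x : ℕ → E) (π : ℕ → F)
    (hπ : ∀ t : ℕ, 1 ≤ t → π t ∈ S ∧
      IsMaxOn (fun ξ =>
        ⟪A (x (t-1) + (((t : ℝ) - 1) / (t : ℝ)) • (x (t-1) - x (t-2))), ξ⟫
        - g ξ - (3 * M ^ 2 / ((t : ℝ) * α)) / 2 * ‖ξ - π (t-1)‖ ^ 2) S (π t))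
    {z : F} (hz : z ∈ S) (N : ℕ) :
    ∑ t ∈ Finset.Icc 1 N, (t : ℝ) * ((⟪A (x t), z⟫ - g z) - (⟪A (x t), π t⟫ - g (π t)))
      ≤ ∑ t ∈ Finset.Icc 1 N, (t : ℝ) ^ 2 * α / 6 * ‖x t - x (t-1)‖ ^ 2
        + 3 * M ^ 2 / α / 2 * ‖z - π 0‖ ^ 2 := by
  have main : ∀ N : ℕ,
    ∑ t ∈ Finset.Icc 1 N, (t : ℝ) * ((⟪A (x t), z⟫ - g z) - (⟪A (x t), π t⟫ - g (π t)))
      ≤ ∑ t ∈ Finset.Icc 1 N, (t : ℝ) ^ 2 * α / 6 * ‖x t - x (t-1)‖ ^ 2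
        + 3 * M ^ 2 / α / 2 * ‖z - π 0‖ ^ 2
        + (N * ⟪A (x N - x (N-1)), z - π N⟫ - (N : ℝ) ^ 2 * α / 6 * ‖x N - x (N-1)‖ ^ 2
            - 3 * M ^ 2 / α / 2 * ‖z - π N‖ ^ 2) := by
    intro N
    induction N with
    | zero => simp
    | succ k ih =>
      rw [Finset.sum_Icc_succ_top (by omega), Finset.sum_Icc_succ_top (by omega)]
      obtain ⟨h1, h2⟩ := hπ (k+1) (by omega)
      have e1 : k + 1 - 1 = k := by omega
      have e2 : k + 1 - 2 = k - 1 := by omega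
      rw [e1, e2] at h2
      simp only [e1]
      set q := x k + ((((k+1 : ℕ) : ℝ) - 1) / ((k+1 : ℕ) : ℝ)) • (x k - x (k-1)) with hq
      have hsc : StrongConvexOn Set.univ 0 (fun ξ => g ξ - ⟪A q, ξ⟫) := by
        rw [strongConvexOn_zero]
        refine ⟨convex_univ, ?_⟩
        intro a _ b _ s t hs ht hst
        have := hg.2 (Set.mem_univ a) (Set.mem_univ b) hs ht hst
        simp only [smul_eq_mul, inner_add_right, inner_smul_right] at *
        linarith
      have h3 := aux_prox (η := 3 * M ^ 2 / (((k+1 : ℕ) : ℝ) * α)) (y := π k) hS hsc h1 hz (by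
        intro w hw
        have := h2 hw
        simp only [Set.mem_ofPred_eq] at this
        linarith)
      have hk : (0:ℝ) < ((k+1 : ℕ) : ℝ) := by positivity
      have h4 := mul_le_mul_of_nonneg_left h3 hk.le
      have hc : 3 * M ^ 2 / (((k+1 : ℕ) : ℝ) * α) = (3 * M ^ 2 / α) / ((k+1 : ℕ) : ℝ) := by
        field_simp
      rw [hc] at h4
      set c := 3 * M ^ 2 / α with hcdef
      have h5 : ((k+1 : ℕ) : ℝ) * (g (π (k+1)) - ⟪A q, π (k+1)⟫) + c / 2 * ‖π (k+1) - π k‖ ^ 2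
          + c / 2 * ‖z - π (k+1)‖ ^ 2
          ≤ ((k+1 : ℕ) : ℝ) * (g z - ⟪A q, z⟫) + c / 2 * ‖z - π k‖ ^ 2 := by
        have r1 : ((k+1 : ℕ) : ℝ) * (g (π (k+1)) - ⟪A q, π (k+1)⟫) + c / 2 * ‖π (k+1) - π k‖ ^ 2
          + c / 2 * ‖z - π (k+1)‖ ^ 2 = ((k+1 : ℕ) : ℝ) * (g (π (k+1)) - ⟪A q, π (k+1)⟫ +
            c / ((k+1 : ℕ) : ℝ) / 2 * ‖π (k+1) - π k‖ ^ 2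
            + (0 + c / ((k+1 : ℕ) : ℝ)) / 2 * ‖z - π (k+1)‖ ^ 2) := by
          field_simp
          ring
        have r2 : ((k+1 : ℕ) : ℝ) * (g z - ⟪A q, z⟫) + c / 2 * ‖z - π k‖ ^ 2 =
          ((k+1 : ℕ) : ℝ) * (g z - ⟪A q, z⟫ + c / ((k+1 : ℕ) : ℝ) / 2 * ‖z - π k‖ ^ 2) := by
          field_simp
        rw [r1, r2]
        exact h4
      have hq2 : ∀ w : F, ((k+1 : ℕ) : ℝ) * ⟪A q, w⟫
          = ((k+1 : ℕ) : ℝ) * ⟪A (x k), w⟫ + k * ⟪A (x k - x (k-1)), w⟫ := by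
        intro w
        rw [hq, map_add, map_smul, inner_add_left, real_inner_smul_left]
        push_cast
        field_simp
        ring
      have h6 := aux_young A hα hA (k : ℝ) (by positivity) (x k - x (k-1)) (π (k+1) - π k)
      have hz1 := hq2 z
      have hz2 := hq2 (π (k+1))
      simp only [map_sub, inner_sub_left, inner_sub_right] at *
      nlinarith
  refine (main N).trans ?_
  have := aux_young A hα hA (N : ℝ) (by positivity) (x N - x (N-1)) (z - π N)
  linarith

/-- **DRAO rate for structured nonsmooth strongly convex problems** (Theorem 3.3(b)):
with `V_i(π;π̄) = ‖π − π̄‖²/2`, `w_t = t`, `θ_t = (t−1)/t`, `η_t = tα/3`,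
`τ_t = 3M_A²/(tα)`, the ergodic iterate `x̄^N = (∑_{t=1}^N t x^t)/(∑_{t=1}^N t)` satisfies
`f(x̄^N) − f(x*) ≤ (α‖x⁰ − x*‖²/3 + 3M_A²D_Π²/α)/N²` for all `N ≥ 1`. -/
theorem DRAO_nonsmooth_strongly_convex_rate
    (n m : ℕ) (hm : 1 ≤ m) (d : Fin m → ℕ)
    (X : Set (EuclideanSpace ℝ (Fin n)))
    (hXne : X.Nonempty) (hXcl : IsClosed X) (hXcv : Convex ℝ X)
    (P : Set (Fin m → ℝ))
    (hPne : P.Nonempty) (hPcl : IsClosed P) (hPcv : Convex ℝ P)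
    (hPsub : ∀ p ∈ P, (∑ i, p i) = 1 ∧ ∀ i, 0 ≤ p i)
    -- `u` is `α`-strongly convex with `α > 0`
    (α : ℝ) (hαpos : 0 < α)
    (u : EuclideanSpace ℝ (Fin n) → ℝ) (hu : StrongConvexOn Set.univ α u)
    -- each `Π_i` is nonempty compact convex
    (Pis : (i : Fin m) → Set (EuclideanSpace ℝ (Fin (d i))))
    (hPisne : ∀ i, (Pis i).Nonempty) (hPiscp : ∀ i, IsCompact (Pis i))
    (hPiscv : ∀ i, Convex ℝ (Pis i))
    (A : (i : Fin m) → EuclideanSpace ℝ (Fin n) →L[ℝ] EuclideanSpace ℝ (Fin (d i)))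
    (fistar : (i : Fin m) → EuclideanSpace ℝ (Fin (d i)) → ℝ)
    (hfistarcv : ∀ i, ConvexOn ℝ Set.univ (fistar i))
    (hfistarlsc : ∀ i, LowerSemicontinuous (fistar i))
    (ρstar : (Fin m → ℝ) → ℝ)
    (hρcv : ConvexOn ℝ Set.univ ρstar) (hρlsc : LowerSemicontinuous ρstar)
    -- scenario costs and objective
    (fi : Fin m → EuclideanSpace ℝ (Fin n) → ℝ)
    (hfi : ∀ i, ∀ xx : EuclideanSpace ℝ (Fin n),
      IsLUB ((fun πi => ⟪A i xx, πi⟫ - fistar i πi) '' Pis i) (fi i xx))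
    (f : EuclideanSpace ℝ (Fin n) → ℝ)
    (hf : ∀ xx, IsLUB ((fun p => (∑ i, p i * fi i xx) - ρstar p) '' P) (f xx - u xx))
    (xstar : EuclideanSpace ℝ (Fin n)) (hxstarX : xstar ∈ X) (hxstar : IsMinOn f X xstar)
    -- problem constants: `M_A ≥ max_i ‖A_i‖`, `D_Π ≥ diam Π_i`
    (MA DPi : ℝ)
    (hMA : ∀ i, ‖A i‖ ≤ MA)
    (hDPi : ∀ i, ∀ ξ ∈ Pis i, ∀ ξ' ∈ Pis i, ‖ξ - ξ'‖ ≤ DPi)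
    -- DRAO iterates (convention `x⁻¹ = x⁰` via `ℕ`-subtraction)
    (x : ℕ → EuclideanSpace ℝ (Fin n)) (hx0 : x 0 ∈ X)
    (π : ℕ → (i : Fin m) → EuclideanSpace ℝ (Fin (d i)))
    (hπ0 : ∀ i, π 0 i ∈ Pis i)
    (hπupd : ∀ t : ℕ, 1 ≤ t → ∀ i, π t i ∈ Pis i ∧
      IsMaxOn (fun ξ =>
        ⟪A i (x (t-1) + (((t : ℝ) - 1) / (t : ℝ)) • (x (t-1) - x (t-2))), ξ⟫
        - fistar i ξ - (3 * MA ^ 2 / ((t : ℝ) * α)) / 2 * ‖ξ - π (t-1) i‖ ^ 2)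
        (Pis i) (π t i))
    (hxupd : ∀ t : ℕ, 1 ≤ t → x t ∈ X ∧
      IsMinOn (fun xx =>
        sSup ((fun p => (∑ i, p i * (⟪A i xx, π t i⟫ - fistar i (π t i))) - ρstar p) '' P)
          + u xx + ((t : ℝ) * α / 3) / 2 * ‖xx - x (t-1)‖ ^ 2) X (x t)) :
    ∀ N : ℕ, 1 ≤ N →
      f ((∑ t ∈ Finset.Icc 1 N, (t : ℝ))⁻¹ • ∑ t ∈ Finset.Icc 1 N, (t : ℝ) • x t) - f xstar
        ≤ (α * ‖x 0 - xstar‖ ^ 2 / 3 + 3 * MA ^ 2 * DPi ^ 2 / α) / (N : ℝ) ^ 2 := by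
  intro N hN
  set W := ∑ t ∈ Finset.Icc 1 N, (t : ℝ) with hW
  have hWval : W = N * (N + 1) / 2 := by
    rw [hW]
    clear * -
    induction N with
    | zero => simp
    | succ k ih => rw [Finset.sum_Icc_succ_top (by omega), ih]; push_cast; ring
  have hNpos : (0:ℝ) < N := by exact_mod_cast hN
  have hWpos : 0 < W := by rw [hWval]; positivity
  set xb := W⁻¹ • ∑ t ∈ Finset.Icc 1 N, (t : ℝ) • x t with hxb
  have hπmem : ∀ t i, π t i ∈ Pis i := by
    intro t i
    rcases Nat.eq_zero_or_pos t with h | h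
    · subst h; exact hπ0 i
    · exact (hπupd t h i).1
  let G : ℕ → EuclideanSpace ℝ (Fin n) → (Fin m → ℝ) → ℝ := fun t xx p =>
    (∑ i, p i * (⟪A i xx, π t i⟫ - fistar i (π t i))) - ρstar p
  have hGle : ∀ t xx, ∀ p ∈ P, G t xx p ≤ f xx - u xx := by
    intro t xx p hp
    refine le_trans ?_ ((hf xx).1 ⟨p, hp, rfl⟩)
    apply sub_le_sub_right
    apply Finset.sum_le_sum
    intro i _
    exact mul_le_mul_of_nonneg_left ((hfi i xx).1 ⟨π t i, hπmem t i, rfl⟩) ((hPsub p hp).2 i)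
  have hbdd : ∀ t xx, BddAbove (G t xx '' P) := by
    intro t xx
    refine ⟨f xx - u xx, ?_⟩
    rintro _ ⟨p, hp, rfl⟩
    exact hGle t xx p hp
  let g : ℕ → EuclideanSpace ℝ (Fin n) → ℝ := fun t xx => sSup (G t xx '' P)
  have hGg : ∀ t xx, ∀ p ∈ P, G t xx p ≤ g t xx := fun t xx p hp =>
    le_csSup (hbdd t xx) ⟨p, hp, rfl⟩
  have hgf : ∀ t xx, g t xx ≤ f xx - u xx := by
    intro t xx
    apply csSup_le (hPne.image _)
    rintro _ ⟨p, hp, rfl⟩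
    exact hGle t xx p hp
  have hsc : ∀ t, StrongConvexOn Set.univ α (fun xx => g t xx + u xx) := by
    intro t
    refine ⟨convex_univ, ?_⟩
    intro a _ b _ r s hr hs hrs
    have h1 := hu.2 (Set.mem_univ a) (Set.mem_univ b) hr hs hrs
    have h2 : g t (r • a + s • b) ≤ r * g t a + s * g t b := by
      apply csSup_le (hPne.image _)
      rintro _ ⟨p, hp, rfl⟩
      have e : G t (r • a + s • b) p = r * G t a p + s * G t b p := by
        have e1 : ∀ i, p i * (⟪A i (r • a + s • b), π t i⟫ - fistar i (π t i))
            = r * (p i * (⟪A i a, π t i⟫ - fistar i (π t i)))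
              + s * (p i * (⟪A i b, π t i⟫ - fistar i (π t i))) := by
          intro i
          rw [map_add, map_smul, map_smul, inner_add_left, real_inner_smul_left,
            real_inner_smul_left]
          linear_combination (p i * fistar i (π t i)) * hrs
        simp only [G, e1, Finset.sum_add_distrib, ← Finset.mul_sum]
        linear_combination (ρstar p) * hrs
      rw [e]
      exact add_le_add (mul_le_mul_of_nonneg_left (hGg t a p hp) hr)
        (mul_le_mul_of_nonneg_left (hGg t b p hp) hs)
    simp only [smul_eq_mul] at *
    linarith
  -- primal step
  have hprimal : ∀ t : ℕ, 1 ≤ t → g t (x t) + u (x t) + ((t : ℝ) * α / 3) / 2 * ‖x t - x (t-1)‖ ^ 2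
      + (α + (t : ℝ) * α / 3) / 2 * ‖xstar - x t‖ ^ 2
      ≤ f xstar + ((t : ℝ) * α / 3) / 2 * ‖xstar - x (t-1)‖ ^ 2 := by
    intro t ht
    obtain ⟨h1, h2⟩ := hxupd t ht
    have h3 := aux_prox (η := (t : ℝ) * α / 3) (y := x (t-1)) hXcv (hsc t) h1 hxstarX
      (fun w hw => h2 hw)
    have h4 := hgf t xstar
    linarith
  have hprimsum : ∀ K : ℕ, ∑ t ∈ Finset.Icc 1 K, (t : ℝ) * (g t (x t) + u (x t))
      + ∑ t ∈ Finset.Icc 1 K, (t : ℝ) ^ 2 * α / 6 * ‖x t - x (t-1)‖ ^ 2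
      + ((K : ℝ) + 1) ^ 2 * α / 6 * ‖xstar - x K‖ ^ 2
      ≤ (∑ t ∈ Finset.Icc 1 K, (t : ℝ)) * f xstar + α / 6 * ‖xstar - x 0‖ ^ 2 := by
    intro K
    induction K with
    | zero => simp
    | succ k ih =>
      rw [Finset.sum_Icc_succ_top (by omega), Finset.sum_Icc_succ_top (by omega),
        Finset.sum_Icc_succ_top (by omega)]
      have h1 := hprimal (k+1) (by omega)
      have e1 : k + 1 - 1 = k := by omega
      simp only [e1] at *
      have hk : (0:ℝ) ≤ ((k+1 : ℕ) : ℝ) := by positivity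
      have h2 := mul_le_mul_of_nonneg_left h1 hk
      have h3 : 0 ≤ (k : ℝ) * α / 6 * ‖xstar - x (k+1)‖ ^ 2 := by positivity
      push_cast at *
      linarith
  have hps := hprimsum N
  have hlast : 0 ≤ ((N : ℝ) + 1) ^ 2 * α / 6 * ‖xstar - x N‖ ^ 2 := by positivity
  set B := ∑ t ∈ Finset.Icc 1 N, (t : ℝ) ^ 2 * α / 6 * ‖x t - x (t-1)‖ ^ 2 with hB
  set c := 3 * MA ^ 2 / α with hc
  have hc0 : 0 ≤ c := by positivity
  -- dual step
  have hfib : ∀ i, W * fi i xb ≤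
      ∑ t ∈ Finset.Icc 1 N, (t : ℝ) * (⟪A i (x t), π t i⟫ - fistar i (π t i))
        + (B + c / 2 * DPi ^ 2) := by
    intro i
    rw [mul_comm, ← le_div_iff₀ hWpos]
    apply (hfi i xb).2
    rintro _ ⟨z, hz, rfl⟩
    rw [le_div_iff₀ hWpos]
    have h1 := aux_dual (A i) hαpos (hMA i) (hPiscv i) (hfistarcv i) x (fun t => π t i)
      (fun t ht => hπupd t ht i) hz N
    have h2 : ‖z - π 0 i‖ ^ 2 ≤ DPi ^ 2 :=
      pow_le_pow_left₀ (norm_nonneg _) (hDPi i z hz _ (hπ0 i)) 2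
    have h3 : c / 2 * ‖z - π 0 i‖ ^ 2 ≤ c / 2 * DPi ^ 2 :=
      mul_le_mul_of_nonneg_left h2 (by positivity)
    have h4 : (⟪A i xb, z⟫ - fistar i z) * W
        = ∑ t ∈ Finset.Icc 1 N, (t : ℝ) * (⟪A i (x t), z⟫ - fistar i z) := by
      have : ⟪A i xb, z⟫ = W⁻¹ * ∑ t ∈ Finset.Icc 1 N, (t : ℝ) * ⟪A i (x t), z⟫ := by
        rw [hxb, map_smul, real_inner_smul_left, map_sum, sum_inner]
        simp only [map_smul, real_inner_smul_left]
      rw [this]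
      simp only [mul_sub, Finset.sum_sub_distrib, ← Finset.sum_mul]
      rw [← hW]
      field_simp
    simp only [mul_sub (_ : ℝ) (_ - _ : ℝ) (_ - _ : ℝ), Finset.sum_sub_distrib] at h1
    simp only [h4]
    simp only [mul_sub, Finset.sum_sub_distrib] at *
    linarith
  have hfu : W * (f xb - u xb) ≤ ∑ t ∈ Finset.Icc 1 N, (t : ℝ) * g t (x t)
      + (B + c / 2 * DPi ^ 2) := by
    rw [mul_comm, ← le_div_iff₀ hWpos]
    apply (hf xb).2
    rintro _ ⟨p, hp, rfl⟩
    rw [le_div_iff₀ hWpos]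
    obtain ⟨hp1, hp0⟩ := hPsub p hp
    have h1 : ∑ t ∈ Finset.Icc 1 N, (t : ℝ) * G t (x t) p
        ≤ ∑ t ∈ Finset.Icc 1 N, (t : ℝ) * g t (x t) :=
      Finset.sum_le_sum fun t _ =>
        mul_le_mul_of_nonneg_left (hGg t (x t) p hp) (by positivity)
    have h2 : ∑ i, p i * (W * fi i xb) ≤ ∑ i, p i * (
      ∑ t ∈ Finset.Icc 1 N, (t : ℝ) * (⟪A i (x t), π t i⟫ - fistar i (π t i))
        + (B + c / 2 * DPi ^ 2)) :=
      Finset.sum_le_sum fun i _ => mul_le_mul_of_nonneg_left (hfib i) (hp0 i)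
    have h3 : ∑ i, p i * (W * fi i xb) = W * ∑ i, p i * fi i xb := by
      rw [Finset.mul_sum]
      exact Finset.sum_congr rfl fun i _ => by ring
    have h4 : ∑ i, p i * (
      ∑ t ∈ Finset.Icc 1 N, (t : ℝ) * (⟪A i (x t), π t i⟫ - fistar i (π t i))
        + (B + c / 2 * DPi ^ 2)) = ∑ t ∈ Finset.Icc 1 N, (t : ℝ) * G t (x t) p
          + W * ρstar p + (B + c / 2 * DPi ^ 2) := by
      simp only [G, mul_add _ (Finset.sum _ _), Finset.sum_add_distrib, ← Finset.sum_mul, hp1,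
        mul_sub (_ : ℝ) (Finset.sum _ _) (_ : ℝ), Finset.sum_sub_distrib]
      rw [one_mul, ← hW]
      simp only [Finset.mul_sum]
      rw [Finset.sum_comm]
      have : ∀ (t : ℕ) i, p i * ((t : ℝ) * (⟪A i (x t), π t i⟫ - fistar i (π t i)))
        = (t : ℝ) * (p i * (⟪A i (x t), π t i⟫ - fistar i (π t i))) := fun t i => by ring
      simp only [this]
      ring
    linarith
  have hub : W * u xb ≤ ∑ t ∈ Finset.Icc 1 N, (t : ℝ) * u (x t) := by
    have hcv : ConvexOn ℝ Set.univ u := by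
      rw [← strongConvexOn_zero]
      exact hu.mono hαpos.le
    have h1 := hcv.map_sum_le (t := Finset.Icc 1 N) (w := fun t : ℕ => W⁻¹ * (t : ℝ)) (p := x)
      (fun t _ => by positivity) (by rw [← Finset.mul_sum, ← hW]; exact inv_mul_cancel₀ hWpos.ne')
      (fun _ _ => Set.mem_univ _)
    simp only [smul_eq_mul, mul_smul, mul_assoc, ← Finset.smul_sum, ← Finset.mul_sum] at h1
    rw [← hxb] at h1
    have h2 := mul_le_mul_of_nonneg_left h1 hWpos.le
    rwa [mul_inv_cancel_left₀ hWpos.ne'] at h2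
  have htot : W * (f xb - f xstar) ≤ α / 6 * ‖x 0 - xstar‖ ^ 2 + c / 2 * DPi ^ 2 := by
    simp only [mul_add, Finset.sum_add_distrib] at hps
    rw [norm_sub_rev (x 0)]
    rw [← hW] at hps
    linarith
  have hfin : f xb - f xstar ≤ (α / 6 * ‖x 0 - xstar‖ ^ 2 + c / 2 * DPi ^ 2) / W := by
    rw [le_div_iff₀ hWpos]; linarith
  refine hfin.trans ?_
  have e : (α * ‖x 0 - xstar‖ ^ 2 / 3 + 3 * MA ^ 2 * DPi ^ 2 / α) / (N : ℝ) ^ 2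
      = (α / 6 * ‖x 0 - xstar‖ ^ 2 + c / 2 * DPi ^ 2) / ((N : ℝ) ^ 2 / 2) := by
    rw [hc]; field_simp; ring
  rw [e]
  apply div_le_div_of_nonneg_left (by positivity) (by positivity)
  rw [hWval]
  nlinarith
end

section
/- DRAO-S rate for smooth convex problems (Theorem 4.1): in the smooth setting, run DRAO-S with stepsizes w_t = t, θ_t = (t−1)/t, τ_t = (t−1)/2, η_t = 2L_f/t, any Δ > 0, S_t = ⌈tΔM_t⌉, M̄_t = S_t/(tΔ), β_s^t = D_PM̄_t/R₀, γ_s^t = R₀M̄_t/D_P, q_s^t = 1, δ₁^t = M̄_t/M̄_{t−1} for t ≥ 2 (δ₁¹ = 1), δ_s^t = 1 for s ≥ 2, where M_t := ‖v^t‖_{2,U*}, R₀ ≥ ‖x⁰ − x*‖ and D_P := max_{p,p̄∈P}√(2U(p,p̄)). Then the ergodic output satisfies f(x̄^N) − f(x*) ≤ 2L_fR₀²/(N(N+1)) + 2D_PR₀/(N(N+1)Δ) for all N ≥ 1, and there exists a uniform bound M̃ with M_t ≤ M̃ for all t ≥ 1. In particular, if Δ = D_P/(L_fR₀), then f(x̄^N)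 − f(x*) ≤ 4L_fR₀²/(N(N+1)) for all N ≥ 1. -/
open RealInnerProductSpace

/-- First-order optimality: convex plus differentiable along a segment. -/
theorem aux_opt {E : Type*} [AddCommGroup E] [Module ℝ E] {X : Set E} {φ q : E → ℝ}
    (hX : Convex ℝ X) (hφ : ConvexOn ℝ Set.univ φ) {y z : E} (hy : y ∈ X) (hz : z ∈ X)
    (hmin : ∀ w ∈ X, φ y + q y ≤ φ w + q w) {D : ℝ}
    (hD : HasDerivAt (fun e : ℝ => q (y + e • (z - y))) D 0) :
    φ y ≤ φ z + D := by
  have h1 := hD.tendsto_slope_zero_right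
  have h2 : ∀ᶠ e : ℝ in nhdsWithin 0 (Set.Ioi 0),
      φ y - φ z ≤ e⁻¹ • (q (y + (0 + e) • (z - y)) - q (y + (0:ℝ) • (z - y))) := by
    filter_upwards [Ioc_mem_nhdsGT (show (0:ℝ) < 1 by norm_num)] with e he
    have he0 : 0 < e := he.1
    have hw : y + e • (z - y) = (1 - e) • y + e • z := by module
    have hmem : y + e • (z - y) ∈ X := by
      rw [hw]; exact hX hy hz (by linarith [he.2]) he0.le (by ring)
    have h3 := hmin _ hmem
    have h4 : φ (y + e • (z - y)) ≤ (1 - e) * φ y + e * φ z := by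
      rw [hw]
      exact hφ.2 (Set.mem_univ _) (Set.mem_univ _) (by linarith [he.2]) he0.le (by ring)
    simp only [zero_add, zero_smul, add_zero, smul_eq_mul]
    rw [← div_eq_inv_mul, le_div_iff₀ he0]
    linarith
  have h5 := ge_of_tendsto h1 h2
  linarith

theorem aux_line_s13 {E : Type*} [NormedAddCommGroup E] [InnerProductSpace ℝ E] [CompleteSpace E]
    {F : E → ℝ} {G : E → E} (hG : ∀ x, HasGradientAt F (G x) x) (x d : E) (s : ℝ) :
    HasDerivAt (fun e : ℝ => F (x + e • d)) ⟪G (x + s • d), d⟫ s := by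
  have h1 : HasDerivAt (fun e : ℝ => x + e • d) d s := by
    simpa using ((hasDerivAt_id s).smul_const d).const_add x
  have h2 : HasDerivAt (fun e : ℝ => F (x + e • d)) _ s :=
    (hG (x + s • d)).hasFDerivAt.comp_hasDerivAt s h1
  exact h2.congr_deriv (by simp)

theorem aux_lower {E : Type*} [NormedAddCommGroup E] [InnerProductSpace ℝ E] [CompleteSpace E]
    {F : E → ℝ} {G : E → E} (hG : ∀ x, HasGradientAt F (G x) x)
    (hF : ConvexOn ℝ Set.univ F) (x z : E) : F x + ⟪G x, z - x⟫ ≤ F z := by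
  have h := aux_line_s13 hG x (z - x) 0
  have := aux_opt (X := Set.univ) (q := fun w => - F w) convex_univ hF
    (Set.mem_univ x) (Set.mem_univ z) (by intro w _; simp) h.neg
  simp at this
  linarith

theorem aux_descent_s13 {E : Type*} [NormedAddCommGroup E] [InnerProductSpace ℝ E] [CompleteSpace E]
    {F : E → ℝ} {G : E → E} {L : ℝ} (hG : ∀ x, HasGradientAt F (G x) x)
    (hL : ∀ x y, ‖G x - G y‖ ≤ L * ‖x - y‖) (x d : E) :
    F (x + d) ≤ F x + ⟪G x, d⟫ + L / 2 * ‖d‖ ^ 2 := by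
  have hd : ∀ s : ℝ, HasDerivAt
      (fun s : ℝ => F (x + s • d) - s * ⟪G x, d⟫ - L / 2 * ‖d‖ ^ 2 * s ^ 2)
      (⟪G (x + s • d), d⟫ - ⟪G x, d⟫ - L * ‖d‖ ^ 2 * s) s := by
    intro s
    have h1 := aux_line_s13 hG x d s
    have h2 := (hasDerivAt_id s).mul_const ⟪G x, d⟫
    have h3 := ((hasDerivAt_id s).pow 2).const_mul (L / 2 * ‖d‖ ^ 2)
    have h4 := (h1.sub h2).sub h3
    refine h4.congr_deriv ?_
    simp; ring
  have hanti : AntitoneOn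
      (fun s : ℝ => F (x + s • d) - s * ⟪G x, d⟫ - L / 2 * ‖d‖ ^ 2 * s ^ 2) (Set.Icc 0 1) := by
    apply antitoneOn_of_deriv_nonpos (convex_Icc 0 1)
    · exact fun s _ => (hd s).continuousAt.continuousWithinAt
    · exact fun s _ => (hd s).differentiableAt.differentiableWithinAt
    · intro s hs
      rw [interior_Icc] at hs
      rw [(hd s).deriv, ← inner_sub_left]
      have h1 := real_inner_le_norm (G (x + s • d) - G x) d
      have h2 := hL (x + s • d) x
      rw [add_sub_cancel_left, norm_smul, Real.norm_eq_abs, abs_of_pos hs.1] at h2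
      have h3 := mul_le_mul_of_nonneg_right h2 (norm_nonneg d)
      nlinarith
  have := hanti (Set.left_mem_Icc.2 zero_le_one) (Set.right_mem_Icc.2 zero_le_one) zero_le_one
  simp at this
  linarith

theorem aux_coco {E : Type*} [NormedAddCommGroup E] [InnerProductSpace ℝ E] [CompleteSpace E]
    {F : E → ℝ} {G : E → E} {L : ℝ} (hLpos : 0 < L) (hG : ∀ x, HasGradientAt F (G x) x)
    (hF : ConvexOn ℝ Set.univ F)
    (hL : ∀ x y, ‖G x - G y‖ ≤ L * ‖x - y‖) (x z : E) :
    ‖G x - G z‖ ^ 2 ≤ 2 * L * (F x - F z - ⟪G z, x - z⟫) := by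
  have h1 := aux_descent_s13 hG hL x (-(L⁻¹) • (G x - G z))
  have h2 := aux_lower hG hF z (x + (-(L⁻¹) • (G x - G z)))
  have e1 : x + (-(L⁻¹) • (G x - G z)) - z = (x - z) + (-(L⁻¹) • (G x - G z)) := by abel
  rw [e1, inner_add_right] at h2
  have e2 : ⟪G x, -(L⁻¹) • (G x - G z)⟫ - ⟪G z, -(L⁻¹) • (G x - G z)⟫
      = -(L⁻¹) * ‖G x - G z‖ ^ 2 := by
    rw [← inner_sub_left, inner_smul_right, real_inner_self_eq_norm_sq]
  have e3 : L / 2 * ‖-(L⁻¹) • (G x - G z)‖ ^ 2 = L⁻¹ / 2 * ‖G x - G z‖ ^ 2 := by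
    rw [norm_smul, mul_pow, Real.norm_eq_abs, sq_abs]; field_simp
  rw [e3] at h1
  have h3 : L⁻¹ / 2 * ‖G x - G z‖ ^ 2 ≤ F x - F z - ⟪G z, x - z⟫ := by linarith
  have h4 := mul_le_mul_of_nonneg_left h3 (show 0 ≤ 2 * L by positivity)
  have e4 : 2 * L * (L⁻¹ / 2 * ‖G x - G z‖ ^ 2) = ‖G x - G z‖ ^ 2 := by field_simp
  linarith

theorem aux_three_y {E : Type*} [NormedAddCommGroup E] [InnerProductSpace ℝ E]
    {X : Set E} (hX : Convex ℝ X) {u : E → ℝ} (hu : ConvexOn ℝ Set.univ u) (vt y0 xp : E)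
    (β η : ℝ) {y z : E} (hy : y ∈ X) (hz : z ∈ X)
    (hmin : IsMinOn (fun w => ⟪w, vt⟫ + u w + β / 2 * ‖w - y0‖ ^ 2 + η / 2 * ‖w - xp‖ ^ 2) X y) :
    ⟪y, vt⟫ + u y + β / 2 * ‖y - y0‖ ^ 2 + η / 2 * ‖y - xp‖ ^ 2 + (β + η) / 2 * ‖y - z‖ ^ 2
      ≤ ⟪z, vt⟫ + u z + β / 2 * ‖z - y0‖ ^ 2 + η / 2 * ‖z - xp‖ ^ 2 := by
  have hexp : ∀ (a : E) (e : ℝ), ‖y + e • (z - y) - a‖ ^ 2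
      = ‖y - a‖ ^ 2 + e * (2 * ⟪y - a, z - y⟫) + e ^ 2 * ‖z - y‖ ^ 2 := by
    intro a e
    have : y + e • (z - y) - a = (y - a) + e • (z - y) := by abel
    rw [this, norm_add_sq_real, inner_smul_right, norm_smul, mul_pow, Real.norm_eq_abs, sq_abs]
    ring
  have hder : HasDerivAt (fun e : ℝ =>
      (fun w => ⟪w, vt⟫ + β / 2 * ‖w - y0‖ ^ 2 + η / 2 * ‖w - xp‖ ^ 2) (y + e • (z - y)))
      (⟪z - y, vt⟫ + β * ⟪y - y0, z - y⟫ + η * ⟪y - xp, z - y⟫) 0 := by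
    have : (fun e : ℝ =>
      (fun w => ⟪w, vt⟫ + β / 2 * ‖w - y0‖ ^ 2 + η / 2 * ‖w - xp‖ ^ 2) (y + e • (z - y)))
      = fun e : ℝ => (⟪y, vt⟫ + β / 2 * ‖y - y0‖ ^ 2 + η / 2 * ‖y - xp‖ ^ 2)
        + id e * (⟪z - y, vt⟫ + β * ⟪y - y0, z - y⟫ + η * ⟪y - xp, z - y⟫)
        + id e ^ 2 * ((β + η) / 2 * ‖z - y‖ ^ 2) := by
      funext e
      simp only [hexp, inner_add_left, inner_smul_left, id]
      simp
      ring
    rw [this]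
    have h1 := (hasDerivAt_id (0:ℝ)).mul_const
      (⟪z - y, vt⟫ + β * ⟪y - y0, z - y⟫ + η * ⟪y - xp, z - y⟫)
    have h2 := ((hasDerivAt_id (0:ℝ)).pow 2).mul_const ((β + η) / 2 * ‖z - y‖ ^ 2)
    refine ((h1.const_add _).add h2).congr_deriv ?_
    simp
  have h := aux_opt hX hu hy hz (q := fun w => ⟪w, vt⟫ + β / 2 * ‖w - y0‖ ^ 2
    + η / 2 * ‖w - xp‖ ^ 2) (by
      intro w hw
      have := isMinOn_iff.1 hmin w hw
      linarith) hder
  have h0 := hexp y0 1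
  have h1 := hexp xp 1
  have e1 : y + (1:ℝ) • (z - y) = z := by module
  rw [e1] at h0 h1
  rw [h0, h1, norm_sub_rev y z]
  rw [inner_sub_left z y vt] at h
  linarith

theorem aux_three_p {m : ℕ} {P : Set (Fin m → ℝ)} (hP : Convex ℝ P)
    {ρ ω : (Fin m → ℝ) → ℝ} (hρ : ConvexOn ℝ Set.univ ρ) (hω : Differentiable ℝ ω)
    {U : (Fin m → ℝ) → (Fin m → ℝ) → ℝ}
    (hU : ∀ p p', U p p' = ω p - ω p' - (fderiv ℝ ω p') (p - p'))
    (l : Fin m → ℝ) (γ : ℝ) (p0 : Fin m → ℝ) {p1 p : Fin m → ℝ} (h1 : p1 ∈ P) (hp : p ∈ P)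
    (hmax : IsMaxOn (fun p' => (∑ i, p' i * l i) - ρ p' - γ * U p' p0) P p1) :
    (∑ i, p i * l i) - ρ p + γ * U p1 p0 + γ * U p p1
      ≤ (∑ i, p1 i * l i) - ρ p1 + γ * U p p0 := by
  have hcv : ConvexOn ℝ Set.univ (fun q : Fin m → ℝ => ρ q + -∑ i, q i * l i) := by
    apply hρ.add
    refine ⟨convex_univ, ?_⟩
    intro a _ b _ s t _ _ _
    apply le_of_eq
    simp only [Pi.add_apply, Pi.smul_apply, smul_eq_mul, add_mul, Finset.sum_add_distrib,
      mul_assoc, ← Finset.mul_sum]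
    ring
  have hline : HasDerivAt (fun e : ℝ => p1 + e • (p - p1)) (p - p1) 0 := by
    simpa using ((hasDerivAt_id (0:ℝ)).smul_const (p - p1)).const_add p1
  have hω1 : HasDerivAt (fun e : ℝ => ω (p1 + e • (p - p1))) ((fderiv ℝ ω p1) (p - p1)) 0 := by
    have : HasDerivAt (fun e : ℝ => ω (p1 + e • (p - p1))) _ 0 :=
      (hω (p1 + (0:ℝ) • (p - p1))).hasFDerivAt.comp_hasDerivAt (0:ℝ) hline
    exact this.congr_deriv (by simp)
  have hlin : HasDerivAt (fun e : ℝ => (fderiv ℝ ω p0) (p1 + e • (p - p1) - p0))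
      ((fderiv ℝ ω p0) (p - p1)) 0 :=
    (fderiv ℝ ω p0).hasFDerivAt.comp_hasDerivAt (0:ℝ) (hline.sub_const p0)
  have hder : HasDerivAt (fun e : ℝ => (fun q => γ * U q p0) (p1 + e • (p - p1)))
      (γ * ((fderiv ℝ ω p1) (p - p1) - (fderiv ℝ ω p0) (p - p1))) 0 := by
    simp only [hU]
    exact ((hω1.sub_const (ω p0)).sub hlin).const_mul γ
  have h := aux_opt hP hcv h1 hp (q := fun q => γ * U q p0) (by
    intro w hw
    have := isMaxOn_iff.1 hmax w hw
    linarith) hder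
  have e : U p p0 = U p1 p0 + U p p1
      + ((fderiv ℝ ω p1) (p - p1) - (fderiv ℝ ω p0) (p - p1)) := by
    have : p - p0 = (p1 - p0) + (p - p1) := by abel
    simp only [hU]
    rw [this, map_add]; ring
  rw [e]
  linarith

theorem aux_M {E : Type*} [NormedAddCommGroup E] [InnerProductSpace ℝ E] {m : ℕ}
    {NU : (Fin m → ℝ) → ℝ}
    (hNUnn : ∀ p, 0 ≤ NU p) (hNU0 : ∀ p, NU p = 0 ↔ p = 0)
    (hNUhom : ∀ (c : ℝ) p, NU (c • p) = |c| * NU p) {v : Fin m → E} {M : ℝ}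
    (hM : IsLUB {r : ℝ | ∃ (p : Fin m → ℝ) (yy : E),
      NU p ≤ 1 ∧ ‖yy‖ ≤ 1 ∧ r = ∑ i, p i * ⟪v i, yy⟫} M) (q : Fin m → ℝ) (w : E) :
    0 ≤ M ∧ ⟪∑ i, q i • v i, w⟫ ≤ M * (NU q * ‖w‖) := by
  have h0 : 0 ≤ M := hM.1 ⟨0, 0, by rw [(hNU0 0).2 rfl]; norm_num, by simp, by simp⟩
  refine ⟨h0, ?_⟩
  by_cases hq : q = 0
  · subst hq; simp; positivity [hNUnn 0]
  by_cases hw : w = 0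
  · subst hw; simp
  have hq1 : 0 < NU q := lt_of_le_of_ne (hNUnn q) (fun h => hq ((hNU0 q).1 h.symm))
  have hw1 : 0 < ‖w‖ := norm_pos_iff.2 hw
  have h := hM.1 ⟨(NU q)⁻¹ • q, ‖w‖⁻¹ • w, by
    rw [hNUhom, abs_of_pos (inv_pos.2 hq1), inv_mul_cancel₀ hq1.ne'], by
    rw [norm_smul, norm_inv, norm_norm, inv_mul_cancel₀ hw1.ne'], rfl⟩
  have e : ∑ i, ((NU q)⁻¹ • q) i * ⟪v i, ‖w‖⁻¹ • w⟫
      = (NU q * ‖w‖)⁻¹ * ⟪∑ i, q i • v i, w⟫ := by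
    rw [sum_inner, Finset.mul_sum]
    refine Finset.sum_congr rfl fun i _ => ?_
    simp only [inner_smul_left, inner_smul_right, Pi.smul_apply, smul_eq_mul, mul_inv]
    simp; ring
  rw [e, inv_mul_le_iff₀ (by positivity)] at h
  linarith

/-- potential -/
noncomputable def PsiAux {E : Type*} [NormedAddCommGroup E] [InnerProductSpace ℝ E] {m : ℕ}
    (B Γ : ℝ) (U : (Fin m → ℝ) → (Fin m → ℝ) → ℝ) (xs : E) (p : Fin m → ℝ)
    (c : ℝ) (v : Fin m → E) (y : E) (p1 p2 : Fin m → ℝ) : ℝ :=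
  B / 2 * ‖y - xs‖ ^ 2 + Γ * U p p1 + Γ * U p1 p2 - c * ⟪∑ i, (p1 i - p2 i) • v i, y - xs⟫

theorem aux_young_s13 {B Γ κ a b : ℝ} (hB : 0 < B) (hκ : B * Γ = κ ^ 2) :
    κ * (a * b) ≤ B / 2 * b ^ 2 + Γ / 2 * a ^ 2 := by
  have h1 : 0 ≤ (B * b - κ * a) ^ 2 := sq_nonneg _
  have h2 : B * (κ * (a * b)) ≤ B * (B / 2 * b ^ 2 + Γ / 2 * a ^ 2) := by
    have : B * (B / 2 * b ^ 2 + Γ / 2 * a ^ 2) = B ^ 2 / 2 * b ^ 2 + (B * Γ) / 2 * a ^ 2 := by ring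
    rw [this, hκ]; nlinarith
  exact le_of_mul_le_mul_left h2 hB

theorem aux_Psi_nonneg {E : Type*} [NormedAddCommGroup E] [InnerProductSpace ℝ E] {m : ℕ}
    {B Γ κ : ℝ} (hB : 0 < B) (hΓ : 0 < Γ) (hκ : B * Γ = κ ^ 2)
    {U : (Fin m → ℝ) → (Fin m → ℝ) → ℝ} {NU : (Fin m → ℝ) → ℝ}
    (hUs : ∀ p p', (1 / 2) * (NU (p - p')) ^ 2 ≤ U p p')
    (xs : E) (p : Fin m → ℝ) {c : ℝ} {v : Fin m → E} (y : E) (p1 p2 : Fin m → ℝ)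
    (hc : ∀ (q : Fin m → ℝ) (w : E), c * ⟪∑ i, q i • v i, w⟫ ≤ κ * (NU q * ‖w‖)) :
    0 ≤ PsiAux B Γ U xs p c v y p1 p2 := by
  unfold PsiAux
  have h1 := hc (p1 - p2) (y - xs)
  simp only [Pi.sub_apply] at h1
  have h2 := aux_young_s13 (a := NU (p1 - p2)) (b := ‖y - xs‖) hB hκ
  have h3 := mul_le_mul_of_nonneg_left (hUs p1 p2) hΓ.le
  have h4 := mul_le_mul_of_nonneg_left (hUs p p1) hΓ.le
  have h5 : 0 ≤ Γ * (1 / 2 * NU (p - p1) ^ 2) := by positivity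
  linarith

theorem aux_step {E : Type*} [NormedAddCommGroup E] [InnerProductSpace ℝ E] {m : ℕ}
    {B Γ κ : ℝ} (hB : 0 < B) (hΓ : 0 < Γ) (hκ : B * Γ = κ ^ 2)
    {U : (Fin m → ℝ) → (Fin m → ℝ) → ℝ} {NU : (Fin m → ℝ) → ℝ}
    (hUs : ∀ p p', (1 / 2) * (NU (p - p')) ^ 2 ≤ U p p')
    (xs xp xu : E) (p : Fin m → ℝ) {c c' δ β γ η : ℝ} (hc : 0 < c) (hc' : c * δ = c')
    (hβ : c * β = B) (hγ : c * γ = Γ) (u : E → ℝ) (ρ : (Fin m → ℝ) → ℝ)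
    {v v' : Fin m → E} (y0 y : E) (p1 p0 pm : Fin m → ℝ) (vt : E) (a : Fin m → ℝ)
    (hcv : ∀ (q : Fin m → ℝ) (w : E), c' * ⟪∑ i, q i • v' i, w⟫ ≤ κ * (NU q * ‖w‖))
    (hvt : vt = (∑ i, p0 i • v i) + δ • ∑ i, (p0 i - pm i) • v' i)
    (hy : ⟪y, vt⟫ + u y + β / 2 * ‖y - y0‖ ^ 2 + η / 2 * ‖y - xp‖ ^ 2 + (β + η) / 2 * ‖y - xs‖ ^ 2
      ≤ ⟪xs, vt⟫ + u xs + β / 2 * ‖xs - y0‖ ^ 2 + η / 2 * ‖xs - xp‖ ^ 2)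
    (hp : (∑ i, p i * (a i + ⟪v i, y - xu⟫)) - ρ p + γ * U p1 p0 + γ * U p p1
      ≤ (∑ i, p1 i * (a i + ⟪v i, y - xu⟫)) - ρ p1 + γ * U p p0) :
    c * ((∑ i, p i * (a i + ⟪v i, y - xu⟫)) - ρ p + u y
        - ((∑ i, p1 i * (a i + ⟪v i, xs - xu⟫)) - ρ p1 + u xs))
      + c * η / 2 * (‖y - xp‖ ^ 2 + ‖y - xs‖ ^ 2 - ‖xp - xs‖ ^ 2)
      ≤ PsiAux B Γ U xs p c' v' y0 p0 pm - PsiAux B Γ U xs p c v y p1 p0 := by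
  unfold PsiAux
  have e1 : ∑ i, (p1 i - p0 i) • v i = (∑ i, p1 i • v i) - ∑ i, p0 i • v i := by
    simp [sub_smul]
  have e2 : (∑ i, p1 i * (a i + ⟪v i, xs - xu⟫))
      = (∑ i, p1 i * (a i + ⟪v i, y - xu⟫)) - ⟪∑ i, p1 i • v i, y - xs⟫ := by
    rw [sum_inner, ← Finset.sum_sub_distrib]
    refine Finset.sum_congr rfl fun i _ => ?_
    rw [real_inner_smul_left]
    simp only [inner_sub_right]; ring
  have h1 := hcv (p0 - pm) (y0 - y)
  simp only [Pi.sub_apply] at h1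
  have h2 := aux_young_s13 (a := NU (p0 - pm)) (b := ‖y0 - y‖) hB hκ
  have h3 := mul_le_mul_of_nonneg_left (hUs p0 pm) hΓ.le
  have h4 := mul_le_mul_of_nonneg_left hy hc.le
  have h5 := mul_le_mul_of_nonneg_left hp hc.le
  rw [e1, e2]
  set D := ∑ i, (p0 i - pm i) • v' i
  set V1 := ∑ i, p1 i • v i
  set V0 := ∑ i, p0 i • v i
  have e3 : ⟪y, vt⟫ = ⟪V0, y⟫ + δ * ⟪D, y⟫ := by
    rw [hvt, inner_add_right, real_inner_smul_right, real_inner_comm, real_inner_comm D]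
  have e4 : ⟪xs, vt⟫ = ⟪V0, xs⟫ + δ * ⟪D, xs⟫ := by
    rw [hvt, inner_add_right, real_inner_smul_right, real_inner_comm, real_inner_comm D]
  rw [e3, e4] at h4
  rw [norm_sub_rev xs y0, norm_sub_rev xs xp] at h4
  rw [norm_sub_rev y0 y] at h2 h1
  simp only [inner_sub_left, inner_sub_right] at *
  subst hc' hβ hγ
  linarith

theorem aux_pi {E : Type*} [NormedAddCommGroup E] [InnerProductSpace ℝ E] [CompleteSpace E]
    {F : E → ℝ} {G : E → E} {L : ℝ} (hLpos : 0 < L) (hG : ∀ x, HasGradientAt F (G x) x)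
    (hF : ConvexOn ℝ Set.univ F)
    (hL : ∀ x y, ‖G x - G y‖ ≤ L * ‖x - y‖) (x xund : ℕ → E) (z : E)
    (hxund : ∀ t : ℕ, 1 ≤ t →
      xund t = (1 + ((t : ℝ) - 1) / 2)⁻¹ •
        ((x (t-1) + (((t : ℝ) - 1) / (t : ℝ)) • (x (t-1) - x (t-2)))
          + (((t : ℝ) - 1) / 2) • xund (t-1))) (N : ℕ) :
    ∑ t ∈ Finset.Icc 1 N, (t : ℝ) * ((F z + ⟪G z, x t - z⟫)
        - (F (xund t) + ⟪G (xund t), x t - xund t⟫))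
      ≤ L * ∑ t ∈ Finset.Icc 1 N, ‖x t - x (t-1)‖ ^ 2 := by
  have hcc := aux_coco hLpos hG hF hL
  have key : ∀ N : ℕ, ∑ t ∈ Finset.Icc 1 N, (t : ℝ) * ((F z + ⟪G z, x t - z⟫)
        - (F (xund t) + ⟪G (xund t), x t - xund t⟫)) + L * ‖x N - x (N-1)‖ ^ 2
      ≤ L * ∑ t ∈ Finset.Icc 1 N, ‖x t - x (t-1)‖ ^ 2
        + N * ⟪G z - G (xund N), x N - x (N-1)⟫
        - N * (N + 1) / 2 * (F (xund N) - F z - ⟪G z, xund N - z⟫) := by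
    intro N
    induction N with
    | zero => simp
    | succ k ih =>
      rw [Finset.sum_Icc_succ_top (by omega), Finset.sum_Icc_succ_top (by omega)]
      have hrec := hxund (k+1) (by omega)
      rw [show k + 1 - 1 = k by omega, show k + 1 - 2 = k - 1 by omega] at hrec
      rw [show k + 1 - 1 = k by omega]
      have hk : (0:ℝ) ≤ k := Nat.cast_nonneg k
      have hr : ∀ h : E, ((k:ℝ) + 1) * (k + 2) / 2 * ⟪h, xund (k+1)⟫
          = (k + 1) * ⟪h, x k⟫ + k * (⟪h, x k⟫ - ⟪h, x (k-1)⟫)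
            + (k + 1) * k / 2 * ⟪h, xund k⟫ := by
        intro h
        rw [hrec]
        push_cast
        simp only [inner_add_right, inner_sub_right, real_inner_smul_right]
        rw [add_sub_cancel_right]
        have : (1 + (k:ℝ) / 2) = (k + 2) / 2 := by ring
        rw [this]
        field_simp
      have hW := hcc (xund k) (xund (k+1))
      have hCS := real_inner_le_norm (G (xund (k+1)) - G (xund k)) (x k - x (k-1))
      rw [norm_sub_rev] at hW
      have hb : (k:ℝ) * ⟪G (xund (k+1)) - G (xund k), x k - x (k-1)⟫
          ≤ (k + 1) * k / 2 * (F (xund k) - F (xund (k+1)) - ⟪G (xund (k+1)), xund k - xund (k+1)⟫)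
            + L * ‖x k - x (k-1)‖ ^ 2 := by
        set W := F (xund k) - F (xund (k+1)) - ⟪G (xund (k+1)), xund k - xund (k+1)⟫
        set g := ‖G (xund (k+1)) - G (xund k)‖
        set d := ‖x k - x (k-1)‖
        have h1 : (k:ℝ) * ⟪G (xund (k+1)) - G (xund k), x k - x (k-1)⟫ ≤ k * (g * d) :=
          mul_le_mul_of_nonneg_left hCS hk
        have h2 : 4 * L * (k * (g * d)) ≤ k ^ 2 * g ^ 2 + 4 * L ^ 2 * d ^ 2 := by
          nlinarith [sq_nonneg ((k:ℝ) * g - 2 * L * d)]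
        have h3 : (k + 1) * k * g ^ 2 ≤ (k + 1) * k * (2 * L * W) :=
          mul_le_mul_of_nonneg_left hW (by positivity)
        have h5 : 0 ≤ k * g ^ 2 := by positivity
        have h4 : 4 * L * (k * (g * d)) ≤ 4 * L * ((k + 1) * k / 2 * W + L * d ^ 2) := by
          nlinarith
        have := le_of_mul_le_mul_left h4 (by positivity)
        linarith
      have r1 := hr (G z)
      have r2 := hr (G (xund (k+1)))
      push_cast
      simp only [inner_sub_left, inner_sub_right] at *
      linarith
  have h := key N
  have hW := hcc (xund N) z
  have hCS := real_inner_le_norm (G z - G (xund N)) (x N - x (N-1))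
  rw [norm_sub_rev] at hW
  have hk : (0:ℝ) ≤ N := Nat.cast_nonneg N
  have hb : (N:ℝ) * ⟪G z - G (xund N), x N - x (N-1)⟫
      ≤ N * (N + 1) / 2 * (F (xund N) - F z - ⟪G z, xund N - z⟫)
        + L * ‖x N - x (N-1)‖ ^ 2 := by
    set W := F (xund N) - F z - ⟪G z, xund N - z⟫
    set g := ‖G z - G (xund N)‖
    set d := ‖x N - x (N-1)‖
    have h1 : (N:ℝ) * ⟪G z - G (xund N), x N - x (N-1)⟫ ≤ N * (g * d) :=
      mul_le_mul_of_nonneg_left hCS hk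
    have h2 : 4 * L * (N * (g * d)) ≤ N ^ 2 * g ^ 2 + 4 * L ^ 2 * d ^ 2 := by
      nlinarith [sq_nonneg ((N:ℝ) * g - 2 * L * d)]
    have h3 : N * (N + 1) * g ^ 2 ≤ N * (N + 1) * (2 * L * W) :=
      mul_le_mul_of_nonneg_left hW (by positivity)
    have h5 : 0 ≤ N * g ^ 2 := by positivity
    have h4 : 4 * L * (N * (g * d)) ≤ 4 * L * (N * (N + 1) / 2 * W + L * d ^ 2) := by
      nlinarith
    have := le_of_mul_le_mul_left h4 (by positivity)
    linarith
  linarith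

theorem aux_NU {m : ℕ} {NU : (Fin m → ℝ) → ℝ}
    (hNUnn : ∀ p, 0 ≤ NU p) (hNU0 : ∀ p, NU p = 0 ↔ p = 0)
    (hNUhom : ∀ (c : ℝ) p, NU (c • p) = |c| * NU p)
    (hNUadd : ∀ p p', NU (p + p') ≤ NU p + NU p') :
    ∃ K : ℝ, 0 ≤ K ∧ ∀ p, ‖p‖ ≤ K * NU p := by
  have hcv : ConvexOn ℝ Set.univ NU := by
    refine ⟨convex_univ, fun a _ b _ s t hs ht _ => ?_⟩
    have := hNUadd (s • a) (t • b)
    rw [hNUhom, hNUhom, abs_of_nonneg hs, abs_of_nonneg ht] at this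
    simpa using this
  have hcont : Continuous NU := by
    rw [← continuousOn_univ]; exact hcv.continuousOn isOpen_univ
  rcases (Metric.sphere (0 : Fin m → ℝ) 1).eq_empty_or_nonempty with he | hne
  · refine ⟨0, le_rfl, fun p => ?_⟩
    by_contra hp
    have hp' : 0 < ‖p‖ := by simpa using hp
    have : ‖p‖⁻¹ • p ∈ Metric.sphere (0 : Fin m → ℝ) 1 := by
      simp [norm_smul, inv_mul_cancel₀ hp'.ne']
    rw [he] at this
    exact this
  · obtain ⟨q, hq, hmin⟩ := (isCompact_sphere (0 : Fin m → ℝ) 1).exists_isMinOn hne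
      hcont.continuousOn
    have hq0 : q ≠ 0 := by rintro rfl; simp at hq
    have hpos : 0 < NU q := lt_of_le_of_ne (hNUnn q) (fun h => hq0 ((hNU0 q).1 h.symm))
    refine ⟨(NU q)⁻¹, by positivity, fun p => ?_⟩
    by_cases hp : p = 0
    · subst hp; simp; have := hNUnn 0; positivity
    have hp' : 0 < ‖p‖ := norm_pos_iff.2 hp
    have : ‖p‖⁻¹ • p ∈ Metric.sphere (0 : Fin m → ℝ) 1 := by
      simp [norm_smul, inv_mul_cancel₀ hp'.ne']
    have h := isMinOn_iff.1 hmin _ this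
    rw [hNUhom, abs_of_pos (by positivity), ← div_eq_inv_mul, le_div_iff₀ hp'] at h
    rw [← div_eq_inv_mul, le_div_iff₀ hpos]
    linarith

theorem aux_jensen {E : Type*} [AddCommGroup E] [Module ℝ E] {φ : E → ℝ}
    (hφ : ConvexOn ℝ Set.univ φ) (I : Finset ℕ) (w : ℕ → ℝ) (hw : ∀ i ∈ I, 0 ≤ w i)
    (hW : 0 < ∑ i ∈ I, w i) (y : ℕ → E) :
    (∑ i ∈ I, w i) * φ ((∑ i ∈ I, w i)⁻¹ • ∑ i ∈ I, w i • y i) ≤ ∑ i ∈ I, w i * φ (y i) := by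
  set W := ∑ i ∈ I, w i with hWd
  have h := hφ.map_sum_le (t := I) (w := fun i => W⁻¹ * w i) (p := y)
    (fun i hi => mul_nonneg (by positivity) (hw i hi))
    (by rw [← Finset.mul_sum, ← hWd, inv_mul_cancel₀ hW.ne']) (fun _ _ => Set.mem_univ _)
  have e1 : ∑ i ∈ I, (W⁻¹ * w i) • y i = W⁻¹ • ∑ i ∈ I, w i • y i := by
    simp [Finset.smul_sum, mul_smul]
  have e2 : ∑ i ∈ I, (W⁻¹ * w i) • φ (y i) = W⁻¹ * ∑ i ∈ I, w i * φ (y i) := by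
    simp [Finset.mul_sum, mul_assoc]
  rw [e1, e2, ← div_eq_inv_mul, le_div_iff₀ hW] at h
  linarith

theorem aux_sq_convex {E : Type*} [NormedAddCommGroup E] [NormedSpace ℝ E] (a : E) :
    ConvexOn ℝ Set.univ (fun w : E => ‖w - a‖ ^ 2) := by
  have := (convexOn_univ_dist a).pow (fun _ _ => dist_nonneg) 2
  simpa [dist_eq_norm, Pi.pow_def] using this

theorem aux_tel (g Φ : ℕ → ℝ) (S : ℕ) (h : ∀ s, 1 ≤ s → s ≤ S → g s ≤ Φ (s-1) - Φ s) :
    ∑ s ∈ Finset.Icc 1 S, g s ≤ Φ 0 - Φ S := by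
  induction S with
  | zero => simp
  | succ k ih =>
    rw [Finset.sum_Icc_succ_top (by omega)]
    have h1 := ih (fun s h1 h2 => h s h1 (by omega))
    have h2 := h (k+1) (by omega) le_rfl
    simp only [Nat.add_sub_cancel] at h2
    linarith


/-- **DRAO-S rate for smooth convex problems** (Theorem 4.1). -/
theorem DRAOS_smooth_convex_rate
    (n m : ℕ) (hm : 1 ≤ m)
    (X : Set (EuclideanSpace ℝ (Fin n)))
    (hXne : X.Nonempty) (hXcl : IsClosed X) (hXcv : Convex ℝ X)
    (P : Set (Fin m → ℝ))
    (hPne : P.Nonempty) (hPcl : IsClosed P) (hPcv : Convex ℝ P)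
    (hPsub : ∀ p ∈ P, (∑ i, p i) = 1 ∧ ∀ i, 0 ≤ p i)
    (u : EuclideanSpace ℝ (Fin n) → ℝ) (hucv : ConvexOn ℝ Set.univ u)
    (ρstar : (Fin m → ℝ) → ℝ)
    (hρcv : ConvexOn ℝ Set.univ ρstar) (hρlsc : LowerSemicontinuous ρstar)
    -- smooth setting: each `f_i` convex differentiable with `L_i`-Lipschitz gradient
    (fi : Fin m → EuclideanSpace ℝ (Fin n) → ℝ)
    (hficv : ∀ i, ConvexOn ℝ Set.univ (fi i))
    (hfidiff : ∀ i, Differentiable ℝ (fi i))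
    (Li : Fin m → ℝ)
    (hLi : ∀ i, ∀ x y : EuclideanSpace ℝ (Fin n),
      ‖gradient (fi i) x - gradient (fi i) y‖ ≤ Li i * ‖x - y‖)
    (Lf : ℝ) (hLfpos : 0 < Lf)
    (hLf : ∀ p ∈ P, ∀ x y : EuclideanSpace ℝ (Fin n),
      ‖∑ i, p i • (gradient (fi i) x - gradient (fi i) y)‖ ≤ Lf * ‖x - y‖)
    -- the objective `f` and its minimizer `x*` over `X`
    (f : EuclideanSpace ℝ (Fin n) → ℝ)
    (hf : ∀ xx, IsLUB ((fun p => (∑ i, p i * fi i xx) - ρstar p) '' P) (f xx - u xx))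
    (xstar : EuclideanSpace ℝ (Fin n)) (hxstarX : xstar ∈ X) (hxstar : IsMinOn f X xstar)
    -- `‖·‖_U` norm, `U` Bregman divergence of `ω`, 1-strongly convex w.r.t. `‖·‖_U`
    (NU : (Fin m → ℝ) → ℝ)
    (hNUnn : ∀ p, 0 ≤ NU p) (hNU0 : ∀ p, NU p = 0 ↔ p = 0)
    (hNUhom : ∀ (c : ℝ) p, NU (c • p) = |c| * NU p)
    (hNUadd : ∀ p p', NU (p + p') ≤ NU p + NU p')
    (U : (Fin m → ℝ) → (Fin m → ℝ) → ℝ)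
    (ω : (Fin m → ℝ) → ℝ) (hωdiff : Differentiable ℝ ω) (hωcv : ConvexOn ℝ Set.univ ω)
    (hUdef : ∀ p p', U p p' = ω p - ω p' - (fderiv ℝ ω p') (p - p'))
    (hUstrong : ∀ p p', (1 / 2) * (NU (p - p')) ^ 2 ≤ U p p')
    -- problem constants: `D_P`, `R₀ ≥ ‖x⁰ − x*‖`, and the conversion factor `Δ > 0`
    (DP R0 Δ : ℝ) (hDPpos : 0 < DP) (hR0pos : 0 < R0) (hΔpos : 0 < Δ)
    (hDP : ∀ p ∈ P, ∀ p' ∈ P, 2 * U p p' ≤ DP ^ 2)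
    -- outer DRAO loop (convention `x⁻¹ = x⁰` via `ℕ`-subtraction) with
    -- `w_t = t`, `θ_t = (t−1)/t`, `τ_t = (t−1)/2`, `η_t = 2L_f/t`
    (x : ℕ → EuclideanSpace ℝ (Fin n)) (hx0 : x 0 ∈ X)
    (hR0 : ‖x 0 - xstar‖ ≤ R0)
    (xund : ℕ → EuclideanSpace ℝ (Fin n)) (hxund0 : xund 0 = x 0)
    (hxund : ∀ t : ℕ, 1 ≤ t →
      xund t = (1 + ((t : ℝ) - 1) / 2)⁻¹ •
        ((x (t-1) + (((t : ℝ) - 1) / (t : ℝ)) • (x (t-1) - x (t-2)))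
          + (((t : ℝ) - 1) / 2) • xund (t-1)))
    -- `v_i^t = π_i^t = ∇f_i(x̲^t)` (the `A_i` are identities), with `v⁰ = v¹`
    (v : ℕ → Fin m → EuclideanSpace ℝ (Fin n))
    (hv : ∀ t, 1 ≤ t → ∀ i, v t i = gradient (fi i) (xund t))
    (hv0 : ∀ i, v 0 i = v 1 i)
    -- `M_t = ‖v^t‖_{2,U*}`, `S_t = ⌈tΔM_t⌉ ≥ 1`, `M̄_t = S_t/(tΔ)`
    (M : ℕ → ℝ)
    (hM : ∀ t, 1 ≤ t → IsLUB {r : ℝ | ∃ (p : Fin m → ℝ) (yy : EuclideanSpace ℝ (Fin n)),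
      NU p ≤ 1 ∧ ‖yy‖ ≤ 1 ∧ r = ∑ i, p i * ⟪v t i, yy⟫} (M t))
    (S : ℕ → ℕ) (hS : ∀ t, 1 ≤ t → S t = ⌈(t : ℝ) * Δ * M t⌉₊)
    (hSpos : ∀ t, 1 ≤ t → 1 ≤ S t)
    (Mbar : ℕ → ℝ) (hMbar : ∀ t, 1 ≤ t → Mbar t = (S t : ℝ) / ((t : ℝ) * Δ))
    -- inner SPS loops with `q_s^t = 1`, `β_s^t = D_P M̄_t/R₀`, `γ_s^t = R₀ M̄_t/D_P`,
    -- `δ₁¹ = 1`, `δ₁^t = M̄_t/M̄_{t−1}` for `t ≥ 2`, `δ_s^t = 1` for `s ≥ 2`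
    (y : ℕ → ℕ → EuclideanSpace ℝ (Fin n))
    (pq : ℕ → ℕ → Fin m → ℝ) (pm : ℕ → Fin m → ℝ)
    (hy01 : y 1 0 = x 0) (hy0t : ∀ t, 2 ≤ t → y t 0 = y (t-1) (S (t-1)))
    (hpq01 : pq 1 0 ∈ P) (hpm1 : pm 1 = pq 1 0)
    (hpq0t : ∀ t, 2 ≤ t → pq t 0 = pq (t-1) (S (t-1)))
    (hpmt : ∀ t, 2 ≤ t → pm t = pq (t-1) (S (t-1) - 1))
    (vtil : ℕ → ℕ → EuclideanSpace ℝ (Fin n))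
    (hvtil11 : vtil 1 1 =
      (∑ i, pq 1 0 i • v 1 i) + (1 : ℝ) • ∑ i, (pq 1 0 i - pm 1 i) • v 0 i)
    (hvtil1t : ∀ t, 2 ≤ t → vtil t 1 =
      (∑ i, pq t 0 i • v t i)
        + (Mbar t / Mbar (t-1)) • ∑ i, (pq t 0 i - pm t i) • v (t-1) i)
    (hvtils : ∀ t, 1 ≤ t → ∀ s : ℕ, 2 ≤ s → vtil t s =
      (∑ i, pq t (s-1) i • v t i)
        + (1 : ℝ) • ∑ i, (pq t (s-1) i - pq t (s-2) i) • v t i)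
    (hyupd : ∀ t, 1 ≤ t → ∀ s : ℕ, 1 ≤ s → s ≤ S t → y t s ∈ X ∧
      IsMinOn (fun yy => ⟪yy, vtil t s⟫ + u yy
        + (DP * Mbar t / R0) / 2 * ‖yy - y t (s-1)‖ ^ 2
        + (2 * Lf / (t : ℝ)) / 2 * ‖yy - x (t-1)‖ ^ 2) X (y t s))
    (hpqupd : ∀ t, 1 ≤ t → ∀ s : ℕ, 1 ≤ s → s ≤ S t → pq t s ∈ P ∧
      IsMaxOn (fun p' =>
        (∑ i, p' i * (fi i (xund t) + ⟪v t i, y t s - xund t⟫))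
        - ρstar p' - (R0 * Mbar t / DP) * U p' (pq t (s-1))) P (pq t s))
    -- phase output `x^t` (ergodic average of the inner iterates, `q_s^t = 1`)
    (hxdef : ∀ t, 1 ≤ t → x t = ((S t : ℝ))⁻¹ • ∑ s ∈ Finset.Icc 1 (S t), y t s) :
    (∀ N : ℕ, 1 ≤ N →
      f ((∑ t ∈ Finset.Icc 1 N, (t : ℝ))⁻¹ • ∑ t ∈ Finset.Icc 1 N, (t : ℝ) • x t) - f xstar
        ≤ 2 * Lf * R0 ^ 2 / ((N : ℝ) * ((N : ℝ) + 1))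
          + 2 * DP * R0 / ((N : ℝ) * ((N : ℝ) + 1) * Δ))
    ∧ (∃ Mtil : ℝ, ∀ t : ℕ, 1 ≤ t → M t ≤ Mtil)
    ∧ (Δ = DP / (Lf * R0) →
        ∀ N : ℕ, 1 ≤ N →
          f ((∑ t ∈ Finset.Icc 1 N, (t : ℝ))⁻¹ • ∑ t ∈ Finset.Icc 1 N, (t : ℝ) • x t)
              - f xstar
            ≤ 4 * Lf * R0 ^ 2 / ((N : ℝ) * ((N : ℝ) + 1))) := by
  -- proof
  have hgrad : ∀ i z, HasGradientAt (fi i) (gradient (fi i) z) z :=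
    fun i z => (hfidiff i z).hasGradientAt
  set B : ℝ := DP / (R0 * Δ) with hBdef
  set Γ : ℝ := R0 / (DP * Δ) with hΓdef
  have hB : 0 < B := by positivity
  have hΓ : 0 < Γ := by positivity
  have hκ : B * Γ = (1 / Δ) ^ 2 := by rw [hBdef, hΓdef]; field_simp
  have hSp : ∀ t, 1 ≤ t → (0:ℝ) < S t := fun t ht => by
    have := hSpos t ht; exact_mod_cast this
  have htp : ∀ t : ℕ, 1 ≤ t → (0:ℝ) < t := fun t ht => by exact_mod_cast ht
  set c : ℕ → ℝ := fun t => (t : ℝ) / S t with hcdef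
  have hcpos : ∀ t, 1 ≤ t → 0 < c t := fun t ht => div_pos (htp t ht) (hSp t ht)
  have hMbpos : ∀ t, 1 ≤ t → 0 < Mbar t := fun t ht => by
    rw [hMbar t ht]; exact div_pos (hSp t ht) (mul_pos (htp t ht) hΔpos)
  have hcM : ∀ t, 1 ≤ t → c t = 1 / (Δ * Mbar t) := fun t ht => by
    rw [hMbar t ht]; have := hSp t ht; have := htp t ht
    simp only [hcdef]; field_simp
  have hMle : ∀ t, 1 ≤ t → M t ≤ Mbar t := fun t ht => by
    have h1 := Nat.le_ceil ((t : ℝ) * Δ * M t)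
    rw [← hS t ht] at h1
    rw [hMbar t ht, le_div_iff₀ (mul_pos (htp t ht) hΔpos)]
    linarith
  have hcv : ∀ t, 1 ≤ t → ∀ (q : Fin m → ℝ) (w : EuclideanSpace ℝ (Fin n)),
      c t * ⟪∑ i, q i • v t i, w⟫ ≤ 1 / Δ * (NU q * ‖w‖) := by
    intro t ht q w
    have h1 := (aux_M hNUnn hNU0 hNUhom (hM t ht) q w).2
    have h2 : 0 ≤ NU q * ‖w‖ := mul_nonneg (hNUnn q) (norm_nonneg w)
    have h3 := mul_le_mul_of_nonneg_right (hMle t ht) h2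
    have h4 := mul_le_mul_of_nonneg_left (h1.trans h3) (hcpos t ht).le
    have hb := hMbpos t ht
    have e : c t * (Mbar t * (NU q * ‖w‖)) = 1 / Δ * (NU q * ‖w‖) := by
      rw [hcM t ht]; field_simp
    linarith
  have hv01 : v 0 = v 1 := funext hv0
  -- key inequality
  have key : ∀ N : ℕ, 1 ≤ N → ∀ p ∈ P,
      (∑ t ∈ Finset.Icc 1 N, (t : ℝ)) *
        ((∑ i, p i * fi i ((∑ t ∈ Finset.Icc 1 N, (t : ℝ))⁻¹ •
            ∑ t ∈ Finset.Icc 1 N, (t : ℝ) • x t)) - ρstar p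
          + u ((∑ t ∈ Finset.Icc 1 N, (t : ℝ))⁻¹ • ∑ t ∈ Finset.Icc 1 N, (t : ℝ) • x t)
          - f xstar) + Lf * ‖x N - xstar‖ ^ 2 ≤ Lf * R0 ^ 2 + DP * R0 / Δ := by
    intro N hN p hp
    set F : EuclideanSpace ℝ (Fin n) → ℝ := fun z => ∑ i, p i * fi i z with hFdef
    set G : EuclideanSpace ℝ (Fin n) → EuclideanSpace ℝ (Fin n) :=
      fun z => ∑ i, p i • gradient (fi i) z with hGdef
    have hFG : ∀ z, HasGradientAt F (G z) z := by
      intro z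
      rw [hasGradientAt_iff_hasFDerivAt]
      have h1 : HasFDerivAt F (∑ i, p i • (InnerProductSpace.toDual ℝ _ (gradient (fi i) z))) z := by
        apply HasFDerivAt.fun_sum
        intro i _
        exact (hgrad i z).hasFDerivAt.const_mul (p i)
      refine h1.congr_fderiv ?_
      simp [hGdef, map_sum]
    have hFc : ConvexOn ℝ Set.univ F := by
      have hp0 := (hPsub p hp).2
      refine ⟨convex_univ, fun a _ b _ s t hs ht hst => ?_⟩
      simp only [hFdef, smul_eq_mul, Finset.mul_sum]
      rw [← Finset.sum_add_distrib]
      refine Finset.sum_le_sum fun i _ => ?_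
      have h1 := (hficv i).2 (Set.mem_univ a) (Set.mem_univ b) hs ht hst
      have h2 := mul_le_mul_of_nonneg_left h1 (hp0 i)
      simp only [smul_eq_mul] at h2
      linarith
    have hGL : ∀ a b, ‖G a - G b‖ ≤ Lf * ‖a - b‖ := by
      intro a b
      have := hLf p hp a b
      simpa only [hGdef, smul_sub, Finset.sum_sub_distrib] using this
    have hlin : ∀ t, 1 ≤ t → ∀ w : EuclideanSpace ℝ (Fin n),
        ∑ i, p i * (fi i (xund t) + ⟪v t i, w - xund t⟫)
          = F (xund t) + ⟪G (xund t), w - xund t⟫ := by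
      intro t ht w
      simp only [hFdef, hGdef, sum_inner, ← Finset.sum_add_distrib]
      refine Finset.sum_congr rfl fun i _ => ?_
      rw [real_inner_smul_left, hv t ht i]; ring
    set En : ℕ → ℝ := fun t => if t = 0 then PsiAux B Γ U xstar p (c 1) (v 0) (x 0) (pq 1 0) (pm 1)
      else PsiAux B Γ U xstar p (c t) (v t) (y t (S t)) (pq t (S t)) (pq t (S t - 1)) with hEn
    -- single phase
    have hphase : ∀ t : ℕ, 1 ≤ t →
        (t : ℝ) * (F (xund t) + ⟪G (xund t), x t - xund t⟫ - ρstar p + u (x t) - f xstar)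
        + Lf * (‖x t - x (t-1)‖ ^ 2 + ‖x t - xstar‖ ^ 2 - ‖x (t-1) - xstar‖ ^ 2)
        ≤ En (t-1) - En t := by
      intro t ht
      have ht0 := htp t ht
      have hS0 := hSp t ht
      have hMb := hMbpos t ht
      set φ : EuclideanSpace ℝ (Fin n) → ℝ := fun w =>
        c t * (F (xund t) + ⟪G (xund t), w - xund t⟫ - ρstar p + u w - f xstar)
        + c t * (2 * Lf / t) / 2 * (‖w - x (t-1)‖ ^ 2 + ‖w - xstar‖ ^ 2 - ‖x (t-1) - xstar‖ ^ 2)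
        with hφdef
      have hφc : ConvexOn ℝ Set.univ φ := by
        have hη : 0 ≤ c t * (2 * Lf / t) / 2 := by have := hcpos t ht; positivity
        refine ⟨convex_univ, fun a _ b _ s r hs hr hsr => ?_⟩
        have hu1 := mul_le_mul_of_nonneg_left
          (hucv.2 (Set.mem_univ a) (Set.mem_univ b) hs hr hsr) (hcpos t ht).le
        have h1 := mul_le_mul_of_nonneg_left
          ((aux_sq_convex (x (t-1))).2 (Set.mem_univ a) (Set.mem_univ b) hs hr hsr) hη
        have h2 := mul_le_mul_of_nonneg_left
          ((aux_sq_convex xstar).2 (Set.mem_univ a) (Set.mem_univ b) hs hr hsr) hη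
        have hr' : r = 1 - s := by linarith
        simp only [smul_eq_mul, hφdef, inner_sub_right, inner_add_right,
          real_inner_smul_right] at *
        subst hr'
        linarith
      have hj := aux_jensen hφc (Finset.Icc 1 (S t)) (fun _ => 1) (fun _ _ => zero_le_one)
        (by simpa using hS0) (y t)
      simp only [Finset.sum_const, Nat.card_Icc, Nat.add_sub_cancel, nsmul_eq_mul, mul_one,
        one_smul, one_mul] at hj
      rw [← hxdef t ht] at hj
      have hφx : (S t : ℝ) * φ (x t) = (t : ℝ) * (F (xund t) + ⟪G (xund t), x t - xund t⟫
          - ρstar p + u (x t) - f xstar)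
        + Lf * (‖x t - x (t-1)‖ ^ 2 + ‖x t - xstar‖ ^ 2 - ‖x (t-1) - xstar‖ ^ 2) := by
        simp only [hφdef, hcdef]; field_simp
      rw [← hφx]
      refine hj.trans ?_
      set Φ : ℕ → ℝ := fun s => if s = 0 then En (t-1) else
        PsiAux B Γ U xstar p (c t) (v t) (y t s) (pq t s) (pq t (s-1)) with hΦ
      have hS1 : S t ≠ 0 := by have := hSpos t ht; omega
      have hfin : En t = Φ (S t) := by
        simp only [hEn, hΦ, if_neg hS1, if_neg (show t ≠ 0 by omega)]
      rw [hfin, show En (t-1) = Φ 0 by simp [hΦ]]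
      apply aux_tel
      intro s hs1 hs2
      -- generic step
      have hstep : ∀ (c' δ : ℝ) (v' : Fin m → EuclideanSpace ℝ (Fin n)) (pmm : Fin m → ℝ),
          c t * δ = c' →
          (∀ (q : Fin m → ℝ) (w : EuclideanSpace ℝ (Fin n)),
            c' * ⟪∑ i, q i • v' i, w⟫ ≤ 1 / Δ * (NU q * ‖w‖)) →
          (vtil t s = (∑ i, pq t (s-1) i • v t i) + δ • ∑ i, (pq t (s-1) i - pmm i) • v' i) →
          φ (y t s) ≤ PsiAux B Γ U xstar p c' v' (y t (s-1)) (pq t (s-1)) pmm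
            - PsiAux B Γ U xstar p (c t) (v t) (y t s) (pq t s) (pq t (s-1)) := by
        intro c' δ v' pmm hc' hb hvt
        obtain ⟨hyX, hymin⟩ := hyupd t ht s hs1 hs2
        obtain ⟨hpP, hpmax⟩ := hpqupd t ht s hs1 hs2
        have hy3 := aux_three_y hXcv hucv (vtil t s) (y t (s-1)) (x (t-1))
          (DP * Mbar t / R0) (2 * Lf / (t : ℝ)) hyX hxstarX hymin
        have hp3 := aux_three_p hPcv hρcv hωdiff hUdef
          (fun i => fi i (xund t) + ⟪v t i, y t s - xund t⟫) (R0 * Mbar t / DP)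
          (pq t (s-1)) hpP hp hpmax
        have h := aux_step hB hΓ hκ hUstrong xstar (x (t-1)) (xund t) p (hcpos t ht) hc'
          (by rw [hcM t ht, hBdef]; field_simp) (by rw [hcM t ht, hΓdef]; field_simp)
          u ρstar (y t (s-1)) (y t s) (pq t s) (pq t (s-1)) pmm (vtil t s)
          (fun i => fi i (xund t)) hb hvt hy3 hp3
        have hfs : (∑ i, pq t s i * (fi i (xund t) + ⟪v t i, xstar - xund t⟫)) - ρstar (pq t s)
            + u xstar ≤ f xstar := by
          have h1 := (hf xstar).1 ⟨pq t s, hpP, rfl⟩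
          simp only at h1
          have h2 : ∑ i, pq t s i * (fi i (xund t) + ⟪v t i, xstar - xund t⟫)
              ≤ ∑ i, pq t s i * fi i xstar := by
            refine Finset.sum_le_sum fun i _ => ?_
            refine mul_le_mul_of_nonneg_left ?_ ((hPsub _ hpP).2 i)
            rw [hv t ht i]
            exact aux_lower (hgrad i) (hficv i) _ _
          linarith
        have hfs' := mul_le_mul_of_nonneg_left hfs (hcpos t ht).le
        rw [hlin t ht] at h
        simp only [hφdef]
        linarith
      by_cases h1 : s = 1
      · subst h1
        simp only [hΦ, if_neg one_ne_zero, Nat.sub_self, if_true]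
        by_cases h2 : t = 1
        · subst h2
          have := hstep (c 1) 1 (v 0) (pm 1) (mul_one _) (by rw [hv01]; exact hcv 1 le_rfl)
            (by simpa using hvtil11)
          simp only [Nat.sub_self] at this
          rw [hy01] at this
          simpa [hEn] using this
        · have ht2 : 2 ≤ t := by omega
          have hMb' := hMbpos (t-1) (by omega)
          have := hstep (c (t-1)) (Mbar t / Mbar (t-1)) (v (t-1)) (pm t)
            (by rw [hcM t ht, hcM (t-1) (by omega)]; field_simp) (hcv (t-1) (by omega))
            (hvtil1t t ht2)
          simp only [Nat.sub_self] at this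
          simp only [hEn, if_neg (show t - 1 ≠ 0 by omega)]
          rw [hy0t t ht2, hpmt t ht2] at this
          rw [hpq0t t ht2] at this ⊢
          exact this
      · have := hstep (c t) 1 (v t) (pq t (s-2)) (mul_one _) (hcv t ht)
          (hvtils t ht s (by omega))
        simp only [hΦ, if_neg (show s ≠ 0 by omega), if_neg (show s - 1 ≠ 0 by omega)]
        rw [show s - 1 - 1 = s - 2 by omega]
        exact this
    -- sum over phases
    have htel := aux_tel (fun t => (t : ℝ) * (F (xund t) + ⟪G (xund t), x t - xund t⟫
        - ρstar p + u (x t) - f xstar) + Lf * ‖x t - x (t-1)‖ ^ 2)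
      (fun t => En t + Lf * ‖x t - xstar‖ ^ 2) N (by
        intro t ht _
        have := hphase t ht
        beta_reduce
        linarith)
    have hENn : 0 ≤ En N := by
      simp only [hEn, if_neg (show N ≠ 0 by omega)]
      exact aux_Psi_nonneg hB hΓ hκ hUstrong xstar p _ _ _ (hcv N hN)
    have hR2 : ‖x 0 - xstar‖ ^ 2 ≤ R0 ^ 2 := by
      have := norm_nonneg (x 0 - xstar); gcongr
    have hE0 : En 0 ≤ DP * R0 / Δ := by
      simp only [hEn, if_true, PsiAux, hpm1]
      have e0 : U (pq 1 0) (pq 1 0) = 0 := by rw [hUdef]; simp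
      have h1 := hDP p hp _ hpq01
      have h2 : B / 2 * ‖x 0 - xstar‖ ^ 2 ≤ B / 2 * R0 ^ 2 := by gcongr
      have h3 : Γ * (2 * U p (pq 1 0)) ≤ Γ * DP ^ 2 := by gcongr
      have e1 : B / 2 * R0 ^ 2 + Γ * DP ^ 2 / 2 = DP * R0 / Δ := by
        rw [hBdef, hΓdef]; field_simp; ring
      simp [e0]
      linarith
    set W : ℝ := ∑ t ∈ Finset.Icc 1 N, (t : ℝ) with hWdef
    have hW : 0 < W := Finset.sum_pos (fun t ht => htp t (Finset.mem_Icc.1 ht).1)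
      ⟨1, Finset.mem_Icc.2 ⟨le_rfl, hN⟩⟩
    set z := W⁻¹ • ∑ t ∈ Finset.Icc 1 N, (t : ℝ) • x t with hz
    have hpi := aux_pi hLfpos hFG hFc hGL x xund z hxund N
    have hju : W * u z ≤ ∑ t ∈ Finset.Icc 1 N, (t : ℝ) * u (x t) :=
      aux_jensen hucv (Finset.Icc 1 N) (fun t => (t : ℝ)) (fun _ _ => Nat.cast_nonneg _) hW x
    have hsz : ∑ t ∈ Finset.Icc 1 N, (t : ℝ) * (F z + ⟪G z, x t - z⟫) = W * F z := by
      have e1 : ∑ t ∈ Finset.Icc 1 N, (t : ℝ) * ⟪G z, x t - z⟫ = 0 := by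
        have : ∀ t : ℕ, (t : ℝ) * ⟪G z, x t - z⟫ = ⟪G z, (t : ℝ) • x t⟫ - (t : ℝ) * ⟪G z, z⟫ := by
          intro t; rw [inner_sub_right, real_inner_smul_right (G z) (x t)]; ring
        have hWz : W • z = ∑ t ∈ Finset.Icc 1 N, (t : ℝ) • x t := by
          rw [hz, smul_inv_smul₀ hW.ne']
        simp only [this]
        rw [Finset.sum_sub_distrib, ← inner_sum, ← Finset.sum_mul, ← hWdef,
          ← real_inner_smul_right, hWz, sub_self]
      simp only [mul_add, Finset.sum_add_distrib, e1, ← Finset.sum_mul, add_zero]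
      rw [← hWdef]
    simp only [mul_sub, mul_add, Finset.sum_add_distrib, Finset.sum_sub_distrib,
      ← Finset.sum_mul, ← Finset.mul_sum] at htel hpi hsz ⊢
    rw [← hWdef] at htel hpi hsz
    have hR2' := mul_le_mul_of_nonneg_left hR2 hLfpos.le
    have hgoal : W * F z - W * ρstar p + W * u z - W * f xstar + Lf * ‖x N - xstar‖ ^ 2
        ≤ Lf * R0 ^ 2 + DP * R0 / Δ := by
      linarith
    exact hgoal
  have hxX : ∀ t, x t ∈ X := by
    intro t
    rcases Nat.eq_zero_or_pos t with h0 | ht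
    · rw [h0]; exact hx0
    · rw [hxdef t ht, Finset.smul_sum]
      apply hXcv.sum_mem
      · intro s _; have := hSp t ht; positivity
      · have := hSp t ht
        simp [this.ne']
      · intro s hs
        exact (hyupd t ht s (Finset.mem_Icc.1 hs).1 (Finset.mem_Icc.1 hs).2).1
  have hWpos : ∀ N : ℕ, 1 ≤ N → 0 < ∑ t ∈ Finset.Icc 1 N, (t : ℝ) := fun N hN =>
    Finset.sum_pos (fun t ht => htp t (Finset.mem_Icc.1 ht).1)
      ⟨1, Finset.mem_Icc.2 ⟨le_rfl, hN⟩⟩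
  have hWval : ∀ N : ℕ, ∑ t ∈ Finset.Icc 1 N, (t : ℝ) = N * (N + 1) / 2 := by
    intro N
    induction N with
    | zero => simp
    | succ k ih => rw [Finset.sum_Icc_succ_top (by omega), ih]; push_cast; ring
  have key2 : ∀ N : ℕ, 1 ≤ N →
      (∑ t ∈ Finset.Icc 1 N, (t : ℝ)) *
        (f ((∑ t ∈ Finset.Icc 1 N, (t : ℝ))⁻¹ • ∑ t ∈ Finset.Icc 1 N, (t : ℝ) • x t)
          - f xstar) + Lf * ‖x N - xstar‖ ^ 2 ≤ Lf * R0 ^ 2 + DP * R0 / Δ := by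
    intro N hN
    have hk := key N hN
    have hW := hWpos N hN
    set W : ℝ := ∑ t ∈ Finset.Icc 1 N, (t : ℝ)
    set z := W⁻¹ • ∑ t ∈ Finset.Icc 1 N, (t : ℝ) • x t
    have h := (hf z).2 (show (Lf * R0 ^ 2 + DP * R0 / Δ - Lf * ‖x N - xstar‖ ^ 2) / W
        + f xstar - u z ∈ upperBounds _ from by
      rintro _ ⟨p, hp, rfl⟩
      have := hk p hp
      have h2 : (∑ i, p i * fi i z) - ρstar p + u z - f xstar
          ≤ (Lf * R0 ^ 2 + DP * R0 / Δ - Lf * ‖x N - xstar‖ ^ 2) / W := by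
        rw [le_div_iff₀ hW]; linarith
      simp only
      linarith)
    have h2 : f z - f xstar
          ≤ (Lf * R0 ^ 2 + DP * R0 / Δ - Lf * ‖x N - xstar‖ ^ 2) / W := by linarith
    rw [le_div_iff₀ hW] at h2
    linarith
  have part1 : ∀ N : ℕ, 1 ≤ N →
      f ((∑ t ∈ Finset.Icc 1 N, (t : ℝ))⁻¹ • ∑ t ∈ Finset.Icc 1 N, (t : ℝ) • x t) - f xstar
        ≤ 2 * Lf * R0 ^ 2 / ((N : ℝ) * ((N : ℝ) + 1))
          + 2 * DP * R0 / ((N : ℝ) * ((N : ℝ) + 1) * Δ) := by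
    intro N hN
    have h := key2 N hN
    have hW := hWpos N hN
    have hN0 := htp N hN
    have h2 : 0 ≤ Lf * ‖x N - xstar‖ ^ 2 := by positivity
    have h3 : f ((∑ t ∈ Finset.Icc 1 N, (t : ℝ))⁻¹ • ∑ t ∈ Finset.Icc 1 N, (t : ℝ) • x t)
        - f xstar ≤ (Lf * R0 ^ 2 + DP * R0 / Δ) / (∑ t ∈ Finset.Icc 1 N, (t : ℝ)) := by
      rw [le_div_iff₀ hW]; linarith
    refine h3.trans (le_of_eq ?_)
    rw [hWval]; field_simp
  refine ⟨part1, ?_, ?_⟩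
  · -- uniform bound
    set K : ℝ := Real.sqrt (R0 ^ 2 + DP * R0 / (Lf * Δ)) with hKdef
    have hK0 : 0 ≤ K := Real.sqrt_nonneg _
    have hxK : ∀ t, ‖x t - xstar‖ ≤ K := by
      intro t
      apply Real.le_sqrt_of_sq_le
      rcases Nat.eq_zero_or_pos t with h0 | ht
      · subst h0
        have h1 : ‖x 0 - xstar‖ ^ 2 ≤ R0 ^ 2 := by
          have := norm_nonneg (x 0 - xstar); gcongr
        have : 0 < DP * R0 / (Lf * Δ) := by positivity
        linarith
      · have h := key2 t ht
        have hmem : (∑ t ∈ Finset.Icc 1 t, (t : ℝ))⁻¹ • ∑ t ∈ Finset.Icc 1 t, (t : ℝ) • x t ∈ X := by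
          rw [Finset.smul_sum]
          simp only [smul_smul]
          apply hXcv.sum_mem
          · intro s _; have := hWpos t ht; positivity
          · rw [← Finset.mul_sum, inv_mul_cancel₀ (hWpos t ht).ne']
          · intro s _; exact hxX s
        have h1 := isMinOn_iff.1 hxstar _ hmem
        have h2 := mul_nonneg (hWpos t ht).le (sub_nonneg.2 h1)
        have h3 : Lf * ‖x t - xstar‖ ^ 2 ≤ Lf * (R0 ^ 2 + DP * R0 / (Lf * Δ)) := by
          have : Lf * (R0 ^ 2 + DP * R0 / (Lf * Δ)) = Lf * R0 ^ 2 + DP * R0 / Δ := by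
            field_simp
          linarith
        exact le_of_mul_le_mul_left h3 hLfpos
    have hxuK : ∀ t, ‖xund t - xstar‖ ≤ 3 * K := by
      intro t
      induction t with
      | zero => rw [hxund0]; linarith [hxK 0]
      | succ k ih =>
        have hrec := hxund (k+1) (by omega)
        rw [show k + 1 - 1 = k by omega, show k + 1 - 2 = k - 1 by omega] at hrec
        push_cast at hrec
        rw [add_sub_cancel_right] at hrec
        have hk : (0:ℝ) ≤ k := Nat.cast_nonneg k
        have hk2 : (0:ℝ) < 1 + (k:ℝ) / 2 := by positivity
        have e : xund (k+1) - xstar = (1 + (k:ℝ) / 2)⁻¹ •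
            ((x k - xstar) + ((k:ℝ) / (k + 1)) • ((x k - xstar) - (x (k-1) - xstar))
              + ((k:ℝ) / 2) • (xund k - xstar)) := by
          have e1 : xstar = (1 + (k:ℝ) / 2)⁻¹ • ((1 + (k:ℝ) / 2) • xstar) :=
            (inv_smul_smul₀ hk2.ne' xstar).symm
          rw [hrec]
          nth_rewrite 1 [e1]
          rw [← smul_sub]
          congr 1
          module
        rw [e, norm_smul, norm_inv, Real.norm_eq_abs, abs_of_pos hk2, inv_mul_le_iff₀ hk2]
        have hθ : (k:ℝ) / (k + 1) ≤ 1 := by rw [div_le_one (by positivity)]; linarith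
        have hθ0 : 0 ≤ (k:ℝ) / (k + 1) := by positivity
        have n1 : ‖((k:ℝ) / (k + 1)) • ((x k - xstar) - (x (k-1) - xstar))‖ ≤ 2 * K := by
          rw [norm_smul, Real.norm_eq_abs, abs_of_nonneg hθ0]
          have h1 := norm_sub_le (x k - xstar) (x (k-1) - xstar)
          have h2 := hxK k
          have h3 := hxK (k-1)
          have h4 := mul_le_mul_of_nonneg_right hθ
            (norm_nonneg ((x k - xstar) - (x (k-1) - xstar)))
          linarith
        have n2 : ‖((k:ℝ) / 2) • (xund k - xstar)‖ ≤ (k:ℝ) / 2 * (3 * K) := by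
          rw [norm_smul, Real.norm_eq_abs, abs_of_nonneg (by positivity)]
          gcongr
        have h1 := norm_add₃_le (a := x k - xstar)
          (b := ((k:ℝ) / (k + 1)) • ((x k - xstar) - (x (k-1) - xstar)))
          (c := ((k:ℝ) / 2) • (xund k - xstar))
        have h2 := hxK k
        linarith
    obtain ⟨C, hC0, hC⟩ := aux_NU hNUnn hNU0 hNUhom hNUadd
    refine ⟨∑ i, C * (‖gradient (fi i) xstar‖ + |Li i| * (3 * K)), fun t ht => ?_⟩
    apply (hM t ht).2
    rintro r ⟨p, w, hp, hw, rfl⟩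
    refine Finset.sum_le_sum fun i _ => ?_
    have h1 : |p i| ≤ C := by
      have h1 := norm_le_pi_norm p i
      have h2 := hC p
      have h3 := mul_le_mul_of_nonneg_left hp hC0
      rw [Real.norm_eq_abs] at h1
      linarith
    have h2 : ‖v t i‖ ≤ ‖gradient (fi i) xstar‖ + |Li i| * (3 * K) := by
      rw [hv t ht i]
      have a1 := hLi i (xund t) xstar
      have a2 := mul_le_mul_of_nonneg_right (le_abs_self (Li i)) (norm_nonneg (xund t - xstar))
      have a3 := mul_le_mul_of_nonneg_left (hxuK t) (abs_nonneg (Li i))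
      have a4 := norm_le_norm_add_norm_sub' (gradient (fi i) (xund t)) (gradient (fi i) xstar)
      linarith
    have h3 : |⟪v t i, w⟫| ≤ ‖v t i‖ := by
      have a1 := abs_real_inner_le_norm (v t i) w
      have a2 := mul_le_mul_of_nonneg_left hw (norm_nonneg (v t i))
      linarith
    calc p i * ⟪v t i, w⟫ ≤ |p i * ⟪v t i, w⟫| := le_abs_self _
      _ = |p i| * |⟪v t i, w⟫| := abs_mul _ _
      _ ≤ C * (‖gradient (fi i) xstar‖ + |Li i| * (3 * K)) :=
        mul_le_mul h1 (h3.trans h2) (abs_nonneg _) hC0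
  · intro hΔ N hN
    refine (part1 N hN).trans (le_of_eq ?_)
    have hN0 := htp N hN
    rw [hΔ]; field_simp; ring
end
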